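/- Let $X_1, X_2, N \geq 1$ and let $(a_n)_{n \leq N}$, $(b_m)_{m \leq N}$ be finite sequences of complex numbers. Then for every $\varepsilon > 0$, $\sum_{D_1 \leq X_1} \sum_{D_2 \leq X_2} \left| \sum_{n, m \leq N} a_n b_m S(1, m, n, 1; D_1, D_2) \right| \ll_{\varepsilon} (X_1 X_2)^{\varepsilon} \|a\|_2 \|b\|_2 \left( X_1 X_2 (X_1 + X_2) + (N X_1 X_2)^{1/2} (X_1 + X_2)^{3/2} + N X_1 X_2 \right)$, where $\|a\|_2^2 = \sum_n |a_n|^2$. -/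

import Mathlib

open Finset

/-- `e(x) = e^{2πix}`. -/
noncomputable def efn (x : ℝ) : ℂ := Complex.exp (2 * Real.pi * Complex.I * x)

/-- Classical Kloosterman sum `S(a,b;c) = ∑_{x mod c, (x,c)=1} e((ax + b x̄)/c)`. -/
noncomputable def Kl (a b : ℤ) (c : ℕ) : ℂ :=
  ∑ x ∈ Finset.range c, if Nat.gcd x c = 1 then
    efn (((a * x + b * (((x : ZMod c)⁻¹).val : ℤ) : ℤ) : ℝ) / c) else 0

/-- A canonical choice of `Y` with `Y·B + Z·C ≡ 1 (mod D)` when `gcd(B,C,D)=1`. -/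
def Ycoef (B C D : ℕ) : ℤ := Nat.gcdA B (Nat.gcd C D)

/-- A canonical choice of `Z` with `Y·B + Z·C ≡ 1 (mod D)` when `gcd(B,C,D)=1`. -/
def Zcoef (B C D : ℕ) : ℤ := Nat.gcdB B (Nat.gcd C D) * Nat.gcdA C D

/-- The GL(3) long Weyl element Kloosterman sum `S(m₁,m₂,n₁,n₂;D₁,D₂)`. -/
noncomputable def SGL3 (m1 m2 n1 n2 : ℤ) (D1 D2 : ℕ) : ℂ :=
  ∑ B1 ∈ Finset.range D1, ∑ C1 ∈ Finset.range D1,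
  ∑ B2 ∈ Finset.range D2, ∑ C2 ∈ Finset.range D2,
    if Nat.gcd B1 (Nat.gcd C1 D1) = 1 ∧ Nat.gcd B2 (Nat.gcd C2 D2) = 1 ∧
       (D1 * D2) ∣ (D1 * C2 + B1 * B2 + D2 * C1) then
      efn ((((m1 * B1 + n1 * (Ycoef B1 C1 D1 * D2 - Zcoef B1 C1 D1 * B2)) : ℤ) : ℝ) / D1
        + (((m2 * B2 + n2 * (Ycoef B2 C2 D2 * D1 - Zcoef B2 C2 D2 * B1)) : ℤ) : ℝ) / D2)
    else 0

lemma efn_add (x y : ℝ) : efn (x + y) = efn x * efn y := by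
  unfold efn
  rw [← Complex.exp_add]; push_cast; ring_nf

lemma efn_int (k : ℤ) : efn k = 1 := by
  unfold efn
  rw [Complex.exp_eq_one_iff]
  exact ⟨k, by push_cast; ring⟩

lemma efn_zero : efn 0 = 1 := by simpa using efn_int 0

lemma efn_eq_one_iff (x : ℝ) : efn x = 1 ↔ ∃ k : ℤ, x = k := by
  constructor
  · intro h
    unfold efn at h
    rw [Complex.exp_eq_one_iff] at h
    obtain ⟨k, hk⟩ := h
    refine ⟨k, ?_⟩
    have h2 : (2 * Real.pi * Complex.I : ℂ) ≠ 0 := Complex.two_pi_I_ne_zero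
    have h3 : (2 * Real.pi * Complex.I : ℂ) * (x - k) = 0 := by
      linear_combination hk
    rcases mul_eq_zero.1 h3 with h4 | h4
    · exact absurd h4 h2
    · have : (x : ℂ) = ((k : ℝ) : ℂ) := by push_cast; linear_combination h4
      exact_mod_cast this
  · rintro ⟨k, rfl⟩; exact efn_int k

lemma norm_efn (x : ℝ) : ‖efn x‖ = 1 := by
  unfold efn
  have : (2 * Real.pi * Complex.I * x : ℂ) = ((2 * Real.pi * x : ℝ) : ℂ) * Complex.I := by
    push_cast; ring
  rw [this, Complex.norm_exp_ofReal_mul_I]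

lemma efn_congr {x y : ℝ} (k : ℤ) (h : x = y + k) : efn x = efn y := by
  rw [h, efn_add, efn_int, mul_one]

lemma efn_neg (x : ℝ) : efn (-x) = (starRingEnd ℂ) (efn x) := by
  unfold efn
  rw [← Complex.exp_conj]
  have h2 : (starRingEnd ℂ) (2 : ℂ) = 2 := Complex.conj_ofNat 2
  simp [h2]

lemma efn_nat_mul (k : ℕ) (x : ℝ) : efn (k * x) = efn x ^ k := by
  unfold efn
  rw [← Complex.exp_nat_mul]; push_cast; ring_nf

lemma efn_div_congr {a b : ℤ} {q : ℕ} (hq : q ≠ 0) (h : (q : ℤ) ∣ a - b) :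
    efn ((a : ℝ) / q) = efn ((b : ℝ) / q) := by
  obtain ⟨k, hk⟩ := h
  apply efn_congr k
  have hq' : (q : ℝ) ≠ 0 := by exact_mod_cast hq
  have : (a : ℝ) = b + q * k := by
    have : a = b + q * k := by linarith
    exact_mod_cast this
  rw [this]; field_simp

lemma efn_geom (q : ℕ) (hq : q ≠ 0) (r : ℤ) :
    ∑ k ∈ range q, efn ((k : ℝ) * ((r : ℝ) / q)) = if (q : ℤ) ∣ r then (q : ℂ) else 0 := by
  have hq' : (q : ℝ) ≠ 0 := by exact_mod_cast hq
  simp_rw [efn_nat_mul]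
  split_ifs with h
  · have : efn ((r : ℝ) / q) = 1 := by
      have := efn_div_congr (a := r) (b := 0) hq (by simpa using h)
      rw [this]; simp [efn_zero]
    simp [this]
  · have h1 : efn ((r : ℝ) / q) ≠ 1 := by
      intro h1
      obtain ⟨k, hk⟩ := (efn_eq_one_iff _).1 h1
      apply h
      refine ⟨k, ?_⟩
      have : (r : ℝ) = q * k := by rw [div_eq_iff hq'] at hk; rw [hk]; ring
      exact_mod_cast this
    rw [geom_sum_eq h1, ← efn_nat_mul]
    have : (q : ℝ) * ((r : ℝ) / q) = r := by field_simp
    rw [this, efn_int]; simp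

lemma parseval_mod {ι : Type*} (q : ℕ) (hq : q ≠ 0) (T : Finset ι) (g : ι → ℤ)
    (hinj : ∀ i ∈ T, ∀ j ∈ T, (q : ℤ) ∣ g i - g j → i = j) (f : ι → ℂ) :
    ∑ s ∈ range q, ‖∑ i ∈ T, f i * efn ((s : ℝ) * ((g i : ℝ) / q))‖ ^ 2
      = q * ∑ i ∈ T, ‖f i‖ ^ 2 := by
  classical
  have key : ∑ s ∈ range q, ((‖∑ i ∈ T, f i * efn ((s : ℝ) * ((g i : ℝ) / q))‖ ^ 2 : ℝ) : ℂ)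
      = q * ∑ i ∈ T, ((‖f i‖ ^ 2 : ℝ) : ℂ) := by
    have h1 : ∀ s ∈ range q,
        ((‖∑ i ∈ T, f i * efn ((s : ℝ) * ((g i : ℝ) / q))‖ ^ 2 : ℝ) : ℂ)
        = ∑ i ∈ T, ∑ j ∈ T, f i * (starRingEnd ℂ) (f j) *
            efn ((s : ℝ) * (((g i - g j : ℤ) : ℝ) / q)) := by
      intro s _
      push_cast
      rw [← Complex.mul_conj', map_sum, sum_mul_sum]
      refine sum_congr rfl fun i _ => sum_congr rfl fun j _ => ?_
      rw [map_mul, ← efn_neg]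
      have : (s : ℝ) * (((g i : ℝ) - g j) / q)
          = s * ((g i : ℝ) / q) + -(s * ((g j : ℝ) / q)) := by ring
      rw [this, efn_add]; ring
    rw [sum_congr rfl h1, sum_comm, mul_sum]
    refine sum_congr rfl fun i hi => ?_
    rw [sum_comm]
    simp_rw [← mul_sum]
    rw [sum_eq_single i]
    · rw [efn_geom q hq, if_pos (by simp)]
      push_cast
      rw [Complex.mul_conj']; ring
    · intro j hj hji
      rw [efn_geom q hq, if_neg, mul_zero]
      intro hd
      exact hji (hinj i hi j hj hd).symm
    · intro h; exact absurd hi h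
  exact_mod_cast key


lemma norm_efn_sub_one (θ : ℝ) (h : |θ| ≤ 1 / 2) : 4 * |θ| ≤ ‖efn θ - 1‖ := by
  have h0 : efn θ = Complex.exp (Complex.I * ((2 * Real.pi * θ : ℝ) : ℂ)) := by
    unfold efn; push_cast; ring_nf
  rw [h0, Complex.norm_exp_I_mul_ofReal_sub_one]
  have h1 : 2 * Real.pi * θ / 2 = Real.pi * θ := by ring
  rw [h1, norm_mul, Real.norm_eq_abs, Real.norm_eq_abs]
  have h2 : |Real.sin (Real.pi * θ)| = Real.sin (Real.pi * |θ|) := by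
    have hnn : 0 ≤ Real.sin (Real.pi * |θ|) := by
      apply Real.sin_nonneg_of_nonneg_of_le_pi
      · positivity
      · nlinarith [Real.pi_pos]
    rcases abs_cases θ with ⟨h3, _⟩ | ⟨h3, _⟩
    · rw [h3] at hnn ⊢; exact abs_of_nonneg hnn
    · rw [h3] at hnn ⊢
      rw [mul_neg, Real.sin_neg] at hnn ⊢
      exact abs_of_nonpos (by linarith)
  rw [h2]
  have h3 := Real.mul_le_sin (x := Real.pi * |θ|) (by positivity) (by nlinarith [Real.pi_pos])
  have h4 : 2 / Real.pi * (Real.pi * |θ|) = 2 * |θ| := by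
    field_simp
  rw [h4] at h3
  rw [abs_of_pos (by norm_num : (0:ℝ) < 2)]
  linarith

lemma dirichlet_bound (L : ℕ) (θ : ℝ) (h : |θ| ≤ 1 / 2) :
    ‖∑ k ∈ range L, efn (k * θ)‖ * (2 * |θ|) ≤ 1 := by
  simp_rw [efn_nat_mul]
  have h1 : (∑ k ∈ range L, efn θ ^ k) * (efn θ - 1) = efn θ ^ L - 1 := geom_sum_mul _ _
  have h2 : ‖∑ k ∈ range L, efn θ ^ k‖ * ‖efn θ - 1‖ ≤ 2 := by
    rw [← norm_mul, h1]
    calc ‖efn θ ^ L - 1‖ ≤ ‖efn θ ^ L‖ + ‖(1:ℂ)‖ := norm_sub_le _ _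
      _ = 2 := by rw [norm_pow, norm_efn]; norm_num
  have h3 := norm_efn_sub_one θ h
  have h4 := mul_le_mul_of_nonneg_left h3 (norm_nonneg (∑ k ∈ range L, efn θ ^ k))
  linarith

noncomputable def phiw (j : ℤ) : ℝ := 2 / (1 + (j : ℝ) ^ 2)

lemma phiw_nonneg (j : ℤ) : 0 ≤ phiw j := by unfold phiw; positivity

lemma phiw_summable : Summable phiw := by
  have h1 : Summable (fun n : ℤ => 2 * (1 / (n : ℝ) ^ 2)) :=
    ((Real.summable_one_div_int_pow (p := 2)).2 (by norm_num)).mul_left 2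
  have h2 : Summable (fun n : ℤ => if n = 0 then (2:ℝ) else 0) :=
    summable_of_ne_finset_zero (s := {0}) (by intro b hb; simp at hb; simp [hb])
  refine Summable.of_nonneg_of_le phiw_nonneg (fun j => ?_) (h1.add h2)
  unfold phiw
  by_cases hj : j = 0
  · simp [hj]
  · have : (0:ℝ) < (j:ℝ)^2 := by positivity
    simp only [hj, if_false, add_zero]
    rw [div_eq_mul_one_div]
    gcongr
    linarith

noncomputable def Kphi : ℝ := ∑' j, phiw j

lemma Kphi_nonneg : 0 ≤ Kphi := tsum_nonneg phiw_nonneg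

lemma sum_phiw_le {ι : Type*} (T : Finset ι) (g : ι → ℤ)
    (hinj : ∀ i ∈ T, ∀ j ∈ T, g i = g j → i = j) : ∑ i ∈ T, phiw (g i) ≤ Kphi := by
  classical
  rw [← sum_image (f := phiw) (g := g) (s := T) (fun i hi j hj h => hinj i hi j hj h)]
  exact phiw_summable.sum_le_tsum _ (fun j _ => phiw_nonneg j)

lemma dirichlet_phi_aux (L R : ℕ) (hR : 1 ≤ R) (hRL : R ≤ L) (α β : ℝ) (σ : ℤ)
    (hσ : |α - β + σ| ≤ 1 / 2) :
    ‖∑ k ∈ range L, efn (k * (α - β))‖ ^ 2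
      ≤ (L : ℝ) ^ 2 * phiw (⌊α * R⌋ - ⌊β * R⌋ + σ * R) := by
  set J : ℤ := ⌊α * R⌋ - ⌊β * R⌋ + σ * R with hJ
  have hR0 : (0:ℝ) < R := by exact_mod_cast hR
  have htriv : ‖∑ k ∈ range L, efn (k * (α - β))‖ ≤ L := by
    refine (norm_sum_le _ _).trans ?_
    simp [norm_efn]
  have hper : ∑ k ∈ range L, efn (k * (α - β)) = ∑ k ∈ range L, efn (k * (α - β + σ)) := by
    refine sum_congr rfl fun k _ => ?_
    symm
    apply efn_congr ((k:ℤ) * σ); push_cast; ring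
  have hD := dirichlet_bound L _ hσ
  rw [← hper] at hD
  set D := ‖∑ k ∈ range L, efn (k * (α - β))‖ with hDdef
  have hD0 : 0 ≤ D := norm_nonneg _
  have hfl : |(J:ℝ)| - 1 ≤ |α - β + σ| * R := by
    have e1 : (J:ℝ) = (α - β + σ) * R - (Int.fract (α * R) - Int.fract (β * R)) := by
      rw [hJ]; push_cast
      unfold Int.fract; ring
    have e2 : |Int.fract (α * R) - Int.fract (β * R)| ≤ 1 := by
      rw [abs_le]
      constructor <;> linarith [Int.fract_nonneg (α * R), Int.fract_nonneg (β * R),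
        Int.fract_lt_one (α * R), Int.fract_lt_one (β * R)]
    rw [e1]
    have := abs_sub ((α - β + σ) * R) (Int.fract (α * R) - Int.fract (β * R))
    rw [abs_mul, abs_of_pos hR0] at this
    linarith
  by_cases hJ1 : |J| ≤ 1
  · have : 1 ≤ phiw J := by
      unfold phiw
      rw [le_div_iff₀ (by positivity)]
      have : (J:ℝ)^2 ≤ 1 := by
        have : |(J:ℝ)| ≤ 1 := by exact_mod_cast hJ1
        exact (sq_le_one_iff_abs_le_one _).2 this
      linarith
    calc D ^ 2 ≤ (L:ℝ)^2 := by gcongr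
      _ = (L:ℝ)^2 * 1 := by ring
      _ ≤ _ := by gcongr
  · have hJ2 : (2:ℝ) ≤ |(J:ℝ)| := by
      have : 2 ≤ |J| := by omega
      exact_mod_cast this
    set t := |(J:ℝ)| with ht
    have h5 : D * t ≤ L := by
      have h6 : D * (2 * (t - 1)) ≤ R := by
        calc D * (2 * (t - 1)) ≤ D * (2 * (|α - β + σ| * R)) := by gcongr
          _ = (D * (2 * |α - β + σ|)) * R := by ring
          _ ≤ 1 * R := by gcongr
          _ = R := one_mul _
      have h7 : D * t ≤ D * (2 * (t-1)) := by
        apply mul_le_mul_of_nonneg_left _ hD0; linarith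
      have h8 : (R:ℝ) ≤ L := by exact_mod_cast hRL
      linarith
    have h9 : (D * t)^2 ≤ (L:ℝ)^2 := by
      apply pow_le_pow_left₀ (by positivity) h5
    unfold phiw
    have ht2 : t^2 = (J:ℝ)^2 := sq_abs _
    rw [← ht2, ← mul_div_assoc, le_div_iff₀ (by positivity)]
    nlinarith [sq_nonneg D]

lemma dirichlet_phi (L R : ℕ) (hR : 1 ≤ R) (hRL : R ≤ L) (α β : ℝ)
    (h0 : 0 ≤ α) (h1 : α < 1) (h2 : 0 ≤ β) (h3 : β < 1) :
    ‖∑ k ∈ range L, efn (k * (α - β))‖ ^ 2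
      ≤ (L : ℝ) ^ 2 * (phiw (⌊α * R⌋ - ⌊β * R⌋) + phiw (⌊α * R⌋ - ⌊β * R⌋ + R)
        + phiw (⌊α * R⌋ - ⌊β * R⌋ - R)) := by
  have p0 := phiw_nonneg (⌊α * R⌋ - ⌊β * R⌋)
  have p1 := phiw_nonneg (⌊α * R⌋ - ⌊β * R⌋ + R)
  have p2 := phiw_nonneg (⌊α * R⌋ - ⌊β * R⌋ - R)
  have hL : (0:ℝ) ≤ (L:ℝ)^2 := by positivity
  by_cases c1 : α - β < -(1/2)
  · have := dirichlet_phi_aux L R hR hRL α β 1 (by rw [abs_le]; push_cast; constructor <;> linarith)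
    refine this.trans (mul_le_mul_of_nonneg_left ?_ hL)
    rw [one_mul]; linarith
  by_cases c2 : 1/2 < α - β
  · have := dirichlet_phi_aux L R hR hRL α β (-1)
      (by rw [abs_le]; push_cast; constructor <;> linarith)
    refine this.trans (mul_le_mul_of_nonneg_left ?_ hL)
    rw [neg_one_mul, ← sub_eq_add_neg]; linarith
  · have := dirichlet_phi_aux L R hR hRL α β 0
      (by rw [abs_le]; push_cast; constructor <;> linarith)
    refine this.trans (mul_le_mul_of_nonneg_left ?_ hL)
    rw [zero_mul, add_zero]; linarith

lemma ls_dual {ι : Type*} (T : Finset ι) (α : ι → ℝ) (R N : ℕ) (hR : 1 ≤ R)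
    (h0 : ∀ i ∈ T, 0 ≤ α i) (h1 : ∀ i ∈ T, α i < 1)
    (hsp : ∀ i ∈ T, ∀ j ∈ T, |α i - α j| * R < 1 → i = j) (c : ι → ℂ) :
    ∑ n ∈ Icc 1 N, ‖∑ i ∈ T, c i * efn (n * α i)‖ ^ 2
      ≤ 12 * Kphi * (R + N) * ∑ i ∈ T, ‖c i‖ ^ 2 := by
  classical
  set M := max N R with hM
  have hM1 : 1 ≤ M := le_trans hR (le_max_right _ _)
  set L := 2 * M with hL
  set G : ℝ → ℝ := fun t => ‖∑ i ∈ T, c i * efn (t * α i)‖ ^ 2 with hG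
  have hG0 : ∀ t, 0 ≤ G t := fun t => by positivity
  have hfloor : ∀ i ∈ T, ∀ j ∈ T, ⌊α i * R⌋ = ⌊α j * R⌋ → i = j := by
    intro i hi j hj hij
    apply hsp i hi j hj
    have := Int.abs_sub_lt_one_of_floor_eq_floor hij
    rwa [← sub_mul, abs_mul, abs_of_nonneg (by positivity : (0:ℝ) ≤ R)] at this
  have low : (M : ℝ) * ∑ n ∈ Icc 1 N, G n ≤ ∑ l ∈ range L, ∑ k ∈ range L, G ((k:ℝ) - l) := by
    calc (M : ℝ) * ∑ n ∈ Icc 1 N, G n = ∑ l ∈ range M, ∑ n ∈ Icc 1 N, G n := by simp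
      _ ≤ ∑ l ∈ range M, ∑ k ∈ range L, G ((k:ℝ) - l) := by
        apply sum_le_sum
        intro l hl
        have e : ∑ n ∈ Icc 1 N, G n = ∑ k ∈ (Icc 1 N).image (fun n => n + l), G ((k:ℝ) - l) := by
          rw [sum_image (by intro a _ b _ h; simpa using h)]
          refine sum_congr rfl fun n _ => ?_
          congr 1; push_cast; ring
        rw [e]
        apply sum_le_sum_of_subset_of_nonneg
        · intro k hk
          simp only [mem_image, mem_Icc, mem_range] at hk hl ⊢
          obtain ⟨n, ⟨_, hn⟩, rfl⟩ := hk
          have : N ≤ M := le_max_left _ _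
          omega
        · intro _ _ _; exact hG0 _
      _ ≤ _ := by
        apply sum_le_sum_of_subset_of_nonneg
        · intro k hk
          simp only [mem_range] at hk ⊢; omega
        · intro _ _ _; exact sum_nonneg fun _ _ => hG0 _
  set κ : ι → ι → ℝ := fun i j => ‖∑ k ∈ range L, efn (k * (α i - α j))‖ ^ 2 with hκ
  have hκ0 : ∀ i j, 0 ≤ κ i j := fun i j => by positivity
  have hκs : ∀ i j, κ i j = κ j i := by
    intro i j
    simp only [hκ]
    congr 1
    rw [← Complex.norm_conj, map_sum]
    congr 1
    refine sum_congr rfl fun k _ => ?_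
    rw [← efn_neg]; congr 1; ring
  have ident : ((∑ l ∈ range L, ∑ k ∈ range L, G ((k:ℝ) - l) : ℝ) : ℂ)
      = ∑ i ∈ T, ∑ j ∈ T, c i * (starRingEnd ℂ) (c j) * (κ i j : ℂ) := by
    push_cast
    have h1 : ∀ l ∈ range L, ∀ k ∈ range L, ((G ((k:ℝ) - l) : ℝ) : ℂ)
        = ∑ i ∈ T, ∑ j ∈ T, c i * (starRingEnd ℂ) (c j) *
            (efn (k * (α i - α j)) * (starRingEnd ℂ) (efn (l * (α i - α j)))) := by
      intro l _ k _
      simp only [hG]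
      push_cast
      rw [← Complex.mul_conj', map_sum, sum_mul_sum]
      refine sum_congr rfl fun i _ => sum_congr rfl fun j _ => ?_
      rw [map_mul, ← efn_neg, ← efn_neg, mul_mul_mul_comm, ← efn_add, ← efn_add]
      congr 2; ring
    rw [sum_congr rfl fun l hl => sum_congr rfl fun k hk => h1 l hl k hk]
    have h2 : ∀ i j, (κ i j : ℂ) = ∑ l ∈ range L, ∑ k ∈ range L,
        efn (k * (α i - α j)) * (starRingEnd ℂ) (efn (l * (α i - α j))) := by
      intro i j
      simp only [hκ]
      push_cast
      rw [← Complex.mul_conj', map_sum, sum_mul_sum, sum_comm]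
    simp_rw [h2, mul_sum]
    rw [sum_congr rfl fun l _ => sum_comm]
    rw [sum_comm]
    refine sum_congr rfl fun i _ => ?_
    rw [sum_congr rfl fun l _ => sum_comm]
    rw [sum_comm]
  have up : ∑ l ∈ range L, ∑ k ∈ range L, G ((k:ℝ) - l)
      ≤ ∑ i ∈ T, ∑ j ∈ T, ‖c i‖ * ‖c j‖ * κ i j := by
    have hn : 0 ≤ ∑ l ∈ range L, ∑ k ∈ range L, G ((k:ℝ) - l) :=
      sum_nonneg fun _ _ => sum_nonneg fun _ _ => hG0 _
    rw [← Complex.norm_of_nonneg hn, ident]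
    refine (norm_sum_le _ _).trans (sum_le_sum fun i _ => (norm_sum_le _ _).trans
      (sum_le_sum fun j _ => ?_))
    rw [norm_mul, norm_mul, Complex.norm_conj, Complex.norm_of_nonneg (hκ0 i j)]
  have up2 : ∑ i ∈ T, ∑ j ∈ T, ‖c i‖ * ‖c j‖ * κ i j ≤ ∑ i ∈ T, ‖c i‖^2 * ∑ j ∈ T, κ i j := by
    have e1 : ∑ i ∈ T, ∑ j ∈ T, ‖c i‖ * ‖c j‖ * κ i j
        ≤ ∑ i ∈ T, ∑ j ∈ T, (‖c i‖^2 * κ i j / 2 + ‖c j‖^2 * κ j i / 2) := by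
      refine sum_le_sum fun i _ => sum_le_sum fun j _ => ?_
      rw [hκs j i]
      nlinarith [mul_nonneg (sq_nonneg (‖c i‖ - ‖c j‖)) (hκ0 i j)]
    refine e1.trans (le_of_eq ?_)
    simp_rw [sum_add_distrib]
    rw [sum_comm (f := fun i j => ‖c j‖^2 * κ j i / 2), ← sum_add_distrib]
    refine sum_congr rfl fun i _ => ?_
    rw [← sum_add_distrib, mul_sum]
    refine sum_congr rfl fun j _ => ?_
    ring
  have row : ∀ i ∈ T, ∑ j ∈ T, κ i j ≤ (L:ℝ)^2 * (3 * Kphi) := by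
    intro i hi
    have hRL : R ≤ L := by have : R ≤ M := le_max_right _ _; omega
    calc ∑ j ∈ T, κ i j ≤ ∑ j ∈ T, (L : ℝ) ^ 2 * (phiw (⌊α i * R⌋ - ⌊α j * R⌋)
        + phiw (⌊α i * R⌋ - ⌊α j * R⌋ + R) + phiw (⌊α i * R⌋ - ⌊α j * R⌋ - R)) :=
          sum_le_sum fun j hj =>
            dirichlet_phi L R hR hRL _ _ (h0 i hi) (h1 i hi) (h0 j hj) (h1 j hj)
      _ ≤ _ := by
        rw [← mul_sum, sum_add_distrib, sum_add_distrib]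
        apply mul_le_mul_of_nonneg_left _ (by positivity)
        have a1 := sum_phiw_le T (fun j => ⌊α i * R⌋ - ⌊α j * R⌋)
          (fun a ha b hb h => hfloor a ha b hb (by linarith))
        have a2 := sum_phiw_le T (fun j => ⌊α i * R⌋ - ⌊α j * R⌋ + R)
          (fun a ha b hb h => hfloor a ha b hb (by linarith))
        have a3 := sum_phiw_le T (fun j => ⌊α i * R⌋ - ⌊α j * R⌋ - R)
          (fun a ha b hb h => hfloor a ha b hb (by linarith))
        linarith
  have fin : (M : ℝ) * ∑ n ∈ Icc 1 N, G n ≤ M * (12 * Kphi * M * ∑ i ∈ T, ‖c i‖^2) := by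
    calc (M : ℝ) * ∑ n ∈ Icc 1 N, G n ≤ ∑ i ∈ T, ‖c i‖^2 * ∑ j ∈ T, κ i j :=
          low.trans (up.trans up2)
      _ ≤ ∑ i ∈ T, ‖c i‖^2 * ((L:ℝ)^2 * (3 * Kphi)) := by
          refine sum_le_sum fun i hi => mul_le_mul_of_nonneg_left (row i hi) (by positivity)
      _ = _ := by
          rw [← sum_mul, hL]; push_cast; ring
  have hMpos : (0:ℝ) < M := by exact_mod_cast hM1
  have fin2 := le_of_mul_le_mul_left fin hMpos
  refine fin2.trans ?_
  have hMle : (M:ℝ) ≤ R + N := by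
    have : M ≤ R + N := by rw [hM]; omega
    exact_mod_cast this
  have := Kphi_nonneg
  gcongr

lemma ls_primal {ι : Type*} (T : Finset ι) (α : ι → ℝ) (R N : ℕ) (hR : 1 ≤ R)
    (h0 : ∀ i ∈ T, 0 ≤ α i) (h1 : ∀ i ∈ T, α i < 1)
    (hsp : ∀ i ∈ T, ∀ j ∈ T, |α i - α j| * R < 1 → i = j) (a : ℕ → ℂ) :
    ∑ i ∈ T, ‖∑ n ∈ Icc 1 N, a n * efn (n * α i)‖ ^ 2
      ≤ 12 * Kphi * (R + N) * ∑ n ∈ Icc 1 N, ‖a n‖ ^ 2 := by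
  set A : ι → ℂ := fun i => ∑ n ∈ Icc 1 N, a n * efn (n * α i) with hA
  set S := ∑ i ∈ T, ‖A i‖ ^ 2 with hS
  set Δ := 12 * Kphi * (R + N) with hΔ
  have hΔ0 : 0 ≤ Δ := by have := Kphi_nonneg; positivity
  have hS0 : 0 ≤ S := by positivity
  have d := ls_dual T α R N hR h0 h1 hsp (fun i => (starRingEnd ℂ) (A i))
  simp only [Complex.norm_conj] at d
  have e1 : (S : ℂ) = ∑ n ∈ Icc 1 N, a n * ∑ i ∈ T, (starRingEnd ℂ) (A i) * efn (n * α i) := by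
    rw [hS]; push_cast
    simp_rw [mul_sum]
    rw [sum_comm]
    refine sum_congr rfl fun i _ => ?_
    rw [← Complex.conj_mul']
    conv_lhs => rw [hA]
    simp only
    rw [mul_sum]
    refine sum_congr rfl fun n _ => ?_
    ring
  have e2 : S ≤ ∑ n ∈ Icc 1 N, ‖a n‖ * ‖∑ i ∈ T, (starRingEnd ℂ) (A i) * efn (n * α i)‖ := by
    rw [← Complex.norm_of_nonneg hS0, e1]
    refine (norm_sum_le _ _).trans (le_of_eq (sum_congr rfl fun n _ => norm_mul _ _))
  have e3 : S ^ 2 ≤ (∑ n ∈ Icc 1 N, ‖a n‖ ^ 2) * (Δ * S) := by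
    calc S ^ 2 ≤ (∑ n ∈ Icc 1 N, ‖a n‖ *
          ‖∑ i ∈ T, (starRingEnd ℂ) (A i) * efn (n * α i)‖) ^ 2 := by gcongr
      _ ≤ _ := sum_mul_sq_le_sq_mul_sq _ _ _
      _ ≤ _ := by gcongr
  rcases hS0.eq_or_lt with h | h
  · rw [← h]; positivity
  · have : S * S ≤ S * (Δ * ∑ n ∈ Icc 1 N, ‖a n‖ ^ 2) := by nlinarith
    exact le_of_mul_le_mul_left this h

lemma large_sieve (Q N : ℕ) (a : ℕ → ℂ) :
    ∑ q ∈ Icc 1 Q, ∑ b ∈ (range q).filter (fun b => Nat.Coprime b q),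
      ‖∑ n ∈ Icc 1 N, a n * efn (n * ((b : ℝ) / q))‖ ^ 2
      ≤ 12 * Kphi * ((Q : ℝ) ^ 2 + N) * ∑ n ∈ Icc 1 N, ‖a n‖ ^ 2 := by
  rcases Nat.eq_zero_or_pos Q with h | hQ
  · subst h
    have := Kphi_nonneg
    simp only [Icc_eq_empty_of_lt Nat.zero_lt_one, sum_empty]
    positivity
  rw [sum_sigma']
  have := ls_primal ((Icc 1 Q).sigma fun q => (range q).filter (fun b => Nat.Coprime b q))
    (fun x => (x.2 : ℝ) / x.1) (Q ^ 2) N (Nat.one_le_pow _ _ hQ) (fun i _ => by positivity)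
    (fun i hi => by
      simp only [mem_sigma, mem_Icc, mem_filter, mem_range] at hi
      have h1 : (0:ℝ) < i.1 := by exact_mod_cast hi.1.1
      rw [div_lt_one h1]; exact_mod_cast hi.2.1)
    (by
      rintro ⟨q, b⟩ hi ⟨q', b'⟩ hj h
      simp only [mem_sigma, mem_Icc, mem_filter, mem_range] at hi hj h
      obtain ⟨⟨hq1, hq2⟩, hb1, hb2⟩ := hi
      obtain ⟨⟨hq1', hq2'⟩, hb1', hb2'⟩ := hj
      have p1 : (0:ℝ) < q := by exact_mod_cast hq1
      have p2 : (0:ℝ) < q' := by exact_mod_cast hq1'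
      have key : |(b:ℝ) * q' - b' * q| < 1 := by
        have e : (b:ℝ) / q - b' / q' = (b * q' - b' * q) / (q * q') := by
          field_simp
        rw [e, abs_div, abs_of_pos (by positivity : (0:ℝ) < q * q')] at h
        have hle : (q:ℝ) * q' ≤ (Q:ℝ) ^ 2 := by
          have : q * q' ≤ Q ^ 2 := by nlinarith
          exact_mod_cast this
        push_cast at h
        calc |(b:ℝ) * q' - b' * q| = |(b:ℝ) * q' - b' * q| / (q * q') * (q * q') := by
              field_simp
          _ ≤ |(b:ℝ) * q' - b' * q| / (q * q') * (Q:ℝ)^2 := by gcongr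
          _ < 1 := h
      have key2 : (b:ℤ) * q' - b' * q = 0 := by
        have : |(b:ℤ) * q' - b' * q| < 1 := by exact_mod_cast key
        exact Int.abs_lt_one_iff.1 this
      have key3 : b * q' = b' * q := by
        have : (b:ℤ) * q' = b' * q := by linarith
        exact_mod_cast this
      have d1 : q ∣ q' := by
        have : q ∣ b * q' := ⟨b', by rw [key3]; ring⟩
        exact (Nat.Coprime.symm hb2).dvd_of_dvd_mul_left this
      have d2 : q' ∣ q := by
        have : q' ∣ b' * q := ⟨b, by rw [← key3]; ring⟩
        exact (Nat.Coprime.symm hb2').dvd_of_dvd_mul_left this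
      have hqq := Nat.dvd_antisymm d1 d2
      subst hqq
      have : b = b' := Nat.eq_of_mul_eq_mul_right (by omega) key3
      subst this; rfl) a
  simpa using this


lemma gcd3_eq_one {a b c : ℕ} (h : ∀ p : ℕ, p.Prime → p ∣ a → p ∣ b → p ∣ c → False) :
    Nat.gcd a (Nat.gcd b c) = 1 := by
  by_contra hne
  obtain ⟨p, hp, hd⟩ := Nat.exists_prime_and_dvd hne
  have h1 := (Nat.dvd_gcd_iff.1 hd)
  have h2 := (Nat.dvd_gcd_iff.1 h1.2)
  exact h p hp h1.1 h2.1 h2.2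

lemma YZ_spec {B C D : ℕ} (h : Nat.gcd B (Nat.gcd C D) = 1) :
    ∃ k : ℤ, Ycoef B C D * B + Zcoef B C D * C - 1 = D * k := by
  have h1 := Nat.gcd_eq_gcd_ab B (Nat.gcd C D)
  have h2 := Nat.gcd_eq_gcd_ab C D
  rw [h] at h1
  unfold Ycoef Zcoef
  refine ⟨-(Nat.gcdB B (Nat.gcd C D) * Nat.gcdB C D), ?_⟩
  push_cast at h1
  linear_combination -h1 - (Nat.gcdB B (Nat.gcd C D)) * h2

/-- integer inverse of `c` modulo `v` -/
noncomputable def iinv (c v : ℕ) : ℤ := (((c : ZMod v)⁻¹).val : ℤ)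

lemma iinv_spec {c v : ℕ} (hv : 0 < v) (h : Nat.gcd c v = 1) :
    ∃ k : ℤ, (c : ℤ) * iinv c v - 1 = v * k := by
  have : NeZero v := ⟨hv.ne'⟩
  have h1 := ZMod.coe_mul_inv_eq_one c h
  have h2 : (((c : ℤ) * iinv c v - 1 : ℤ) : ZMod v) = 0 := by
    unfold iinv
    push_cast
    rw [ZMod.natCast_zmod_val, h1, sub_self]
  exact (ZMod.intCast_zmod_eq_zero_iff_dvd _ _).1 h2

lemma iinv_congr {a b v : ℕ} (h : (a : ZMod v) = b) : iinv a v = iinv b v := by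
  unfold iinv; rw [h]

/-- summand after parametrisation -/
noncomputable def parTerm (v d1 d2 b : ℕ) (x m n : ℤ) (c μ : ℕ) : ℂ :=
  efn (((n * (v * iinv μ d1) + (μ * d2 - d1 * c * x) : ℤ) : ℝ) / (v * d1 : ℕ)
    + ((m * (v * b) + (d1 * x - d2 * μ * iinv c v) : ℤ) : ℝ) / (v * d2 : ℕ))

lemma core (v d1 d2 b : ℕ) (hv : 0 < v) (hd1 : 0 < d1) (hd2 : 0 < d2) (x y : ℤ)
    (hxy : (b : ℤ) * x + d2 * y = 1) (m n : ℤ) :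
    (∑ p ∈ (range (v * d1) ×ˢ (range (v * d1) ×ˢ range (v * d2))).filter (fun p =>
      Nat.gcd p.1 (Nat.gcd p.2.1 (v * d1)) = 1 ∧ Nat.gcd (v * b) (Nat.gcd p.2.2 (v * d2)) = 1 ∧
       ((v * d1) * (v * d2)) ∣ ((v * d1) * p.2.2 + p.1 * (v * b) + (v * d2) * p.2.1)),
      efn ((((1 * p.1 + n * (Ycoef p.1 p.2.1 (v * d1) * (v * d2 : ℕ)
          - Zcoef p.1 p.2.1 (v * d1) * (v * b : ℕ))) : ℤ) : ℝ) / (v * d1 : ℕ)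
        + (((m * (v * b : ℕ) + 1 * (Ycoef (v * b) p.2.2 (v * d2) * (v * d1 : ℕ)
          - Zcoef (v * b) p.2.2 (v * d2) * p.1)) : ℤ) : ℝ) / (v * d2 : ℕ)))
    = ∑ p ∈ (range v ×ˢ range (v * d1)).filter (fun p =>
        Nat.gcd p.1 v = 1 ∧ Nat.gcd p.2 d1 = 1), parTerm v d1 d2 b x m n p.1 p.2 := by
  have hvd1 : (0:ℤ) < v * d1 := by positivity
  have hvd2 : (0:ℤ) < v * d2 := by positivity
  have hbd : ∀ p : ℕ, p.Prime → p ∣ b → p ∣ d2 → False := by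
    intro p hp h1 h2
    obtain ⟨s, hs⟩ := h1
    obtain ⟨t, ht⟩ := h2
    have : (p : ℤ) ∣ 1 := ⟨s * x + t * y, by rw [← hxy, hs, ht]; push_cast; ring⟩
    have := Int.natCast_dvd_natCast.1 (by simpa using this : (p:ℤ) ∣ ((1:ℕ):ℤ))
    exact hp.one_lt.ne' (Nat.dvd_one.1 this)
  have basic : ∀ B1 C1 C2 : ℕ,
      ((v * d1) * (v * d2)) ∣ ((v * d1) * C2 + B1 * (v * b) + (v * d2) * C1) →
      ∃ k : ℤ, (d1 : ℤ) * C2 + b * B1 + d2 * C1 = v * d1 * d2 * k := by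
    rintro B1 C1 C2 ⟨k, hk⟩
    refine ⟨k, ?_⟩
    have hk' : (v:ℤ) * d1 * C2 + B1 * (v * b) + (v * d2) * C1 = (v * d1) * (v * d2) * k := by
      exact_mod_cast hk
    have hv' : (v:ℤ) ≠ 0 := by positivity
    apply mul_left_cancel₀ hv'
    linear_combination hk'
  apply sum_nbij (fun p => (p.2.2 % v, ((y * p.1 - x * p.2.1) % (v * d1 : ℤ)).toNat))
  · rintro ⟨B1, C1, C2⟩ hp
    simp only [mem_filter, mem_product, mem_range] at hp ⊢
    obtain ⟨⟨hB1, hC1, hC2⟩, g1, g2, hdv⟩ := hp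
    obtain ⟨k, hk⟩ := basic _ _ _ hdv
    obtain ⟨k1, hk1⟩ := YZ_spec g1
    have hmn := Int.emod_nonneg (y * B1 - x * C1) hvd1.ne'
    have hml := Int.emod_lt_of_pos (y * B1 - x * C1) hvd1
    refine ⟨⟨Nat.mod_lt _ hv, ?_⟩, ?_, ?_⟩
    · zify; rw [Int.toNat_of_nonneg hmn]; exact hml
    · by_contra hne
      obtain ⟨p, hp, hd⟩ := Nat.exists_prime_and_dvd hne
      have h1 := Nat.dvd_gcd_iff.1 hd
      have h2 : p ∣ C2 := (Nat.dvd_mod_iff h1.2).1 h1.1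
      have : p ∣ Nat.gcd (v * b) (Nat.gcd C2 (v * d2)) :=
        Nat.dvd_gcd (h1.2.mul_right _) (Nat.dvd_gcd h2 (h1.2.mul_right _))
      rw [g2] at this
      exact hp.one_lt.ne' (Nat.dvd_one.1 this)
    · set M := ((y * B1 - x * C1) % (v * d1 : ℤ)).toNat with hM
      have hMi : (M : ℤ) = (y * B1 - x * C1) - (v * d1) * ((y * B1 - x * C1) / (v * d1)) := by
        rw [hM, Int.toNat_of_nonneg hmn, Int.emod_def]
      set t := (y * B1 - x * C1) / (v * d1 : ℤ)
      rw [← Nat.coprime_iff_gcd_eq_one, ← Nat.isCoprime_iff_coprime]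
      set Y1 := Ycoef B1 C1 (v * d1)
      set Z1 := Zcoef B1 C1 (v * d1)
      push_cast at hk1
      refine ⟨Y1 * d2 - Z1 * b, -(y * (d2 * v * k1 - Z1 * (v * d2 * k - C2))
        - x * (Y1 * (v * d2 * k - C2) - b * v * k1) - (Y1 * d2 - Z1 * b) * v * t), ?_⟩
      rw [hMi]
      linear_combination hxy + (y * d2 + x * b) * hk1 + (- y * Z1 - x * Y1) * hk
  · rintro ⟨B1, C1, C2⟩ hp ⟨B1', C1', C2'⟩ hp' heq
    simp only [coe_filter, mem_product, mem_range, Set.mem_ofPred_eq] at hp hp'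
    obtain ⟨⟨hB1, hC1, hC2⟩, g1, g2, hdv⟩ := hp
    obtain ⟨⟨hB1', hC1', hC2'⟩, g1', g2', hdv'⟩ := hp'
    obtain ⟨k, hk⟩ := basic _ _ _ hdv
    obtain ⟨k', hk'⟩ := basic _ _ _ hdv'
    simp only [Prod.mk.injEq] at heq
    obtain ⟨e1, e2⟩ := heq
    have e1' : ((C2:ℤ)) % v = C2' % v := by exact_mod_cast e1
    have e2' : (y * B1 - x * C1) % (v * d1 : ℤ) = (y * B1' - x * C1') % (v * d1 : ℤ) := by
      have h1 := Int.emod_nonneg (y * B1 - x * C1) hvd1.ne'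
      have h2 := Int.emod_nonneg (y * B1' - x * C1') hvd1.ne'
      omega
    obtain ⟨s, hs⟩ := Int.emod_eq_emod_iff_emod_sub_eq_zero.1 e1' |> Int.dvd_of_emod_eq_zero
    obtain ⟨t, ht⟩ := Int.emod_eq_emod_iff_emod_sub_eq_zero.1 e2' |> Int.dvd_of_emod_eq_zero
    have small : ∀ (q : ℤ) (a b : ℕ), (a:ℤ) < q → (b:ℤ) < q → q ∣ (a:ℤ) - b → a = b := by
      intro q a b ha hb hd
      have : (a:ℤ) - b = 0 := Int.eq_zero_of_abs_lt_dvd hd (by rw [abs_lt]; constructor <;> omega)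
      omega
    have f1 : B1 = B1' := by
      apply small (v * d1) _ _ (by exact_mod_cast hB1) (by exact_mod_cast hB1')
      refine ⟨t * d2 - x * s + x * d2 * (k - k'), ?_⟩
      linear_combination d2 * ht - x * d1 * hs + x * hk - x * hk' - (B1 - B1') * hxy
    have f2 : C1 = C1' := by
      apply small (v * d1) _ _ (by exact_mod_cast hC1) (by exact_mod_cast hC1')
      refine ⟨-t * b - y * s + y * d2 * (k - k'), ?_⟩
      linear_combination -b * ht - y * d1 * hs + y * hk - y * hk' - (C1 - C1') * hxy
    subst f1; subst f2
    have f3 : C2 = C2' := by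
      apply small (v * d2) _ _ (by exact_mod_cast hC2) (by exact_mod_cast hC2')
      refine ⟨k - k', ?_⟩
      have : (d1:ℤ) ≠ 0 := by positivity
      apply mul_left_cancel₀ this
      linear_combination hk - hk'
    subst f3; rfl
  · rintro ⟨c, μ⟩ hp
    simp only [coe_filter, mem_product, mem_range, Set.mem_ofPred_eq] at hp
    obtain ⟨⟨hc, hμ⟩, gc, gμ⟩ := hp
    have lift : ∀ (q z : ℤ), 0 < q → ∃ (w : ℕ) (s : ℤ), (w:ℤ) < q ∧ (w:ℤ) = z - q * s := by
      intro q z hq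
      refine ⟨(z % q).toNat, z / q, ?_, ?_⟩
      · rw [Int.toNat_of_nonneg (Int.emod_nonneg _ hq.ne')]; exact Int.emod_lt_of_pos _ hq
      · rw [Int.toNat_of_nonneg (Int.emod_nonneg _ hq.ne'), Int.emod_def]
    obtain ⟨B1, s, hB1, eB1⟩ := lift (v * d1) (μ * d2 - d1 * c * x) hvd1
    obtain ⟨C1, t, hC1, eC1⟩ := lift (v * d1) (-μ * b - d1 * c * y) hvd1
    obtain ⟨C2, r, hC2, eC2⟩ := lift (v * d2) (c + v * (b * s + d2 * t)) hvd2
    have emu : (y * B1 - x * C1 : ℤ) = μ - (v * d1) * (y * s - x * t) := by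
      rw [eB1, eC1]; linear_combination (μ:ℤ) * hxy
    refine ⟨(B1, C1, C2), ?_, ?_⟩
    · simp only [coe_filter, mem_product, mem_range, Set.mem_ofPred_eq]
      refine ⟨⟨by exact_mod_cast hB1, by exact_mod_cast hC1, by exact_mod_cast hC2⟩, ?_, ?_, ?_⟩
      · apply gcd3_eq_one
        intro p hp h1 h2 h3
        have hpi : Prime (p:ℤ) := Nat.prime_iff_prime_int.1 hp
        have i1 : (p:ℤ) ∣ B1 := by exact_mod_cast h1
        have i2 : (p:ℤ) ∣ C1 := by exact_mod_cast h2
        have i3 : (p:ℤ) ∣ v * d1 := by exact_mod_cast h3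
        have hpμ : (p:ℤ) ∣ μ := by
          have : (μ:ℤ) = y * B1 - x * C1 + (v * d1) * (y * s - x * t) := by rw [emu]; ring
          rw [this]
          exact dvd_add (dvd_sub (i1.mul_left _) (i2.mul_left _)) (i3.mul_right _)
        have hpμ' : p ∣ μ := by exact_mod_cast hpμ
        have hpd1 : ¬ p ∣ d1 := by
          intro hh
          have := Nat.dvd_gcd hpμ' hh
          rw [gμ] at this
          exact hp.one_lt.ne' (Nat.dvd_one.1 this)
        have hpv : p ∣ v := (hp.dvd_mul.1 h3).resolve_right hpd1
        have hpc : ¬ p ∣ c := by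
          intro hh
          have := Nat.dvd_gcd hh hpv
          rw [gc] at this
          exact hp.one_lt.ne' (Nat.dvd_one.1 this)
        have hpdc : ¬ (p:ℤ) ∣ d1 * c := by
          intro hh
          rcases hpi.dvd_or_dvd hh with h | h
          · exact hpd1 (by exact_mod_cast h)
          · exact hpc (by exact_mod_cast h)
        have hx : (p:ℤ) ∣ x := by
          have : (p:ℤ) ∣ d1 * c * x := by
            have e : (d1 * c * x : ℤ) = μ * d2 - (v * d1) * s - B1 := by rw [eB1]; ring
            rw [e]
            exact dvd_sub (dvd_sub (hpμ.mul_right _) (i3.mul_right _)) i1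
          exact (hpi.dvd_or_dvd this).resolve_left hpdc
        have hy : (p:ℤ) ∣ y := by
          have : (p:ℤ) ∣ d1 * c * y := by
            have e : (d1 * c * y : ℤ) = μ * (-b) - (v * d1) * t - C1 := by rw [eC1]; ring
            rw [e]
            exact dvd_sub (dvd_sub (hpμ.mul_right _) (i3.mul_right _)) i2
          exact (hpi.dvd_or_dvd this).resolve_left hpdc
        have : (p:ℤ) ∣ 1 := by
          rw [← hxy]; exact dvd_add (hx.mul_left _) (hy.mul_left _)
        exact hpi.not_isUnit (isUnit_of_dvd_one this)
      · apply gcd3_eq_one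
        intro p hp h1 h2 h3
        have hpv : p ∣ v := by
          by_contra hn
          exact hbd p hp ((hp.dvd_mul.1 h1).resolve_left hn) ((hp.dvd_mul.1 h3).resolve_left hn)
        have hpc : (p:ℤ) ∣ c := by
          have e : (c:ℤ) = C2 - v * (b * s + d2 * t - d2 * r) := by rw [eC2]; ring
          rw [e]
          exact dvd_sub (by exact_mod_cast h2) ((Int.natCast_dvd_natCast.2 hpv).mul_right _)
        have := Nat.dvd_gcd (by exact_mod_cast hpc : p ∣ c) hpv
        rw [gc] at this
        exact hp.one_lt.ne' (Nat.dvd_one.1 this)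
      · zify
        refine ⟨-r, ?_⟩
        rw [eB1, eC1, eC2]
        linear_combination (-v * d1 * c : ℤ) * hxy
    · simp only [Prod.mk.injEq]
      constructor
      · zify
        have e : (C2:ℤ) = c + v * (b * s + d2 * t - d2 * r) := by rw [eC2]; ring
        rw [e, Int.add_mul_emod_self_left]
        exact Int.emod_eq_of_lt (by positivity) (by exact_mod_cast hc)
      · rw [emu, sub_eq_add_neg, ← mul_neg, Int.add_mul_emod_self_left,
          Int.emod_eq_of_lt (by positivity) (by exact_mod_cast hμ)]
        simp
  · rintro ⟨B1, C1, C2⟩ hp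
    simp only [mem_filter, mem_product, mem_range] at hp ⊢
    obtain ⟨⟨hB1, hC1, hC2⟩, g1, g2, hdv⟩ := hp
    obtain ⟨k, hk⟩ := basic _ _ _ hdv
    obtain ⟨k1, hk1⟩ := YZ_spec g1
    obtain ⟨k2, hk2⟩ := YZ_spec g2
    have hmn := Int.emod_nonneg (y * B1 - x * C1) hvd1.ne'
    set M := ((y * B1 - x * C1) % (v * d1 : ℤ)).toNat with hM
    have hMi : (M : ℤ) = (y * B1 - x * C1) - (v * d1) * ((y * B1 - x * C1) / (v * d1)) := by
      rw [hM, Int.toNat_of_nonneg hmn, Int.emod_def]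
    set t := (y * B1 - x * C1) / (v * d1 : ℤ)
    set Y1 := Ycoef B1 C1 (v * d1)
    set Z1 := Zcoef B1 C1 (v * d1)
    set Y2 := Ycoef (v * b) C2 (v * d2)
    set Z2 := Zcoef (v * b) C2 (v * d2)
    push_cast at hk1 hk2
    have hlam : ∃ r : ℤ, (Y1 * d2 - Z1 * b) * M - 1 = d1 * r := by
      refine ⟨(y * (d2 * v * k1 - Z1 * (v * d2 * k - C2))
        - x * (Y1 * (v * d2 * k - C2) - b * v * k1) - (Y1 * d2 - Z1 * b) * v * t), ?_⟩
      rw [hMi]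
      linear_combination hxy + (y * d2 + x * b) * hk1 + (- y * Z1 - x * Y1) * hk
    obtain ⟨r, hr⟩ := hlam
    have gM : Nat.gcd M d1 = 1 := by
      rw [← Nat.coprime_iff_gcd_eq_one, ← Nat.isCoprime_iff_coprime]
      exact ⟨Y1 * d2 - Z1 * b, -r, by linear_combination hr⟩
    obtain ⟨q1, hq1⟩ := iinv_spec hd1 gM
    set c := C2 % v with hc
    have hci : (c:ℤ) = C2 - v * ((C2:ℤ) / v) := by
      rw [hc]; push_cast; rw [Int.emod_def]
    set j := (C2:ℤ) / v
    have gcv : Nat.gcd c v = 1 := by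
      rw [← Nat.coprime_iff_gcd_eq_one, ← Nat.isCoprime_iff_coprime]
      exact ⟨Z2, Y2 * b - d2 * k2 + Z2 * j, by rw [hci]; linear_combination hk2⟩
    obtain ⟨q2, hq2⟩ := iinv_spec hv gcv
    unfold parTerm
    rw [efn_add, efn_add]
    set I1 := iinv M d1
    set I2 := iinv c v
    congr 1
    · apply efn_div_congr (by positivity)
      set lam := Y1 * d2 - Z1 * b with hlamdef
      have hdiff : lam - I1 = d1 * (I1 * r - lam * q1) := by
        linear_combination I1 * hr - lam * hq1
      refine ⟨n * (I1 * r - lam * q1) + d2 * t + x * d2 * k - x * j, ?_⟩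
      push_cast
      rw [hci, hMi]
      have hB : (B1:ℤ) = (y * B1 - x * C1) * d2 - x * d1 * C2 + x * v * d1 * d2 * k := by
        linear_combination x * hk - B1 * hxy
      linear_combination hB + n * v * hdiff + n * v * hlamdef
    · apply efn_div_congr (by positivity)
      have hZ : ∃ w : ℤ, Z2 - I2 = v * w := by
        have a1 : Z2 * c - 1 = v * (d2 * k2 - Y2 * b - Z2 * j) := by
          rw [hci]; linear_combination hk2
        exact ⟨I2 * (d2 * k2 - Y2 * b - Z2 * j) - Z2 * q2, by
          linear_combination I2 * a1 - Z2 * hq2⟩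
      obtain ⟨w, hw⟩ := hZ
      have hB : (B1:ℤ) = (y * B1 - x * C1) * d2 - x * d1 * C2 + x * v * d1 * d2 * k := by
        linear_combination x * hk - B1 * hxy
      refine ⟨Y2 * d1 * y + d1 * x * k2 - Z2 * x * d1 * k - w * (y * B1 - x * C1)
          - I2 * d1 * t, ?_⟩
      push_cast
      rw [hMi]
      linear_combination (-Z2) * hB + d1 * x * hk2 - d2 * (y * B1 - x * C1) * hw
        - Y2 * v * d1 * hxy


lemma sum_range_mul_split {M : Type*} [AddCommMonoid M] (v d : ℕ) (f : ℕ → M) :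
    ∑ i ∈ range (v * d), f i = ∑ r ∈ range d, ∑ k ∈ range v, f (r + d * k) := by
  rw [sum_comm]
  induction v with
  | zero => simp
  | succ v ih =>
    rw [Nat.succ_mul, sum_range_add, ih, sum_range_succ]
    congr 1
    refine sum_congr rfl fun i _ => ?_
    congr 1; ring

/-- first integer parameter -/
noncomputable def spar (v d1 d2 c : ℕ) : ℤ := ((d2 : ℤ) - d1 * iinv c v) / v
/-- second integer parameter -/
noncomputable def tpar (v d1 d2 c : ℕ) : ℤ := ((d1 : ℤ) - d2 * c) / v

lemma t_dvd {v d1 d2 c : ℕ} (hv : 0 < v) (hc : Nat.gcd c v = 1)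
    (h : (v : ℤ) ∣ (d2 : ℤ) - d1 * iinv c v) : (v : ℤ) ∣ (d1 : ℤ) - d2 * c := by
  obtain ⟨k, hk⟩ := h
  obtain ⟨q, hq⟩ := iinv_spec hv hc
  exact ⟨-c * k - d1 * q, by linear_combination (-c:ℤ) * hk - d1 * hq⟩

lemma ksum (v d1 d2 b : ℕ) (hv : 0 < v) (hd1 : 0 < d1) (hd2 : 0 < d2) (x y : ℤ)
    (hxy : (b : ℤ) * x + d2 * y = 1) (m n : ℤ) (c : ℕ) (hc : Nat.gcd c v = 1) :
    ∑ μ ∈ range (v * d1), (if Nat.gcd μ d1 = 1 then parTerm v d1 d2 b x m n c μ else 0)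
    = if (v : ℤ) ∣ (d2 : ℤ) - d1 * iinv c v then
        (v : ℂ) * Kl (spar v d1 d2 c) n d1 *
          efn (((m * b + tpar v d1 d2 c * iinv b d2 : ℤ) : ℝ) / d2) else 0 := by
  have hvr : (v : ℝ) ≠ 0 := by positivity
  have hd1r : (d1 : ℝ) ≠ 0 := by positivity
  have hd2r : (d2 : ℝ) ≠ 0 := by positivity
  have hterm : ∀ r k : ℕ, parTerm v d1 d2 b x m n c (r + d1 * k)
      = parTerm v d1 d2 b x m n c r *
        efn ((k : ℝ) * ((((d2 : ℤ) - d1 * iinv c v : ℤ) : ℝ) / v)) := by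
    intro r k
    unfold parTerm
    rw [← efn_add]
    have : iinv (r + d1 * k) d1 = iinv r d1 := iinv_congr (by push_cast; simp)
    rw [this]
    congr 1
    push_cast
    field_simp
    ring
  rw [sum_range_mul_split]
  have hg : ∀ r k : ℕ, Nat.gcd (r + d1 * k) d1 = Nat.gcd r d1 := by
    intro r k; simp
  simp_rw [hg, hterm]
  have h2 : ∀ r ∈ range d1, ∑ k ∈ range v, (if Nat.gcd r d1 = 1 then
      parTerm v d1 d2 b x m n c r *
        efn ((k : ℝ) * ((((d2 : ℤ) - d1 * iinv c v : ℤ) : ℝ) / v)) else 0)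
      = if Nat.gcd r d1 = 1 then parTerm v d1 d2 b x m n c r *
        (if (v : ℤ) ∣ (d2 : ℤ) - d1 * iinv c v then (v:ℂ) else 0) else 0 := by
    intro r _
    split_ifs with h1 h2
    · rw [← mul_sum, efn_geom v hv.ne', if_pos h2]
    · rw [← mul_sum, efn_geom v hv.ne', if_neg h2]
    · simp
  rw [sum_congr rfl h2]
  split_ifs with hdv
  · unfold Kl
    rw [mul_sum, sum_mul]
    refine sum_congr rfl fun r _ => ?_
    split_ifs with h1
    · rw [mul_comm, mul_assoc]
      congr 1
      have hs : (d2 : ℤ) - d1 * iinv c v = v * spar v d1 d2 c := by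
        unfold spar; rw [Int.mul_ediv_cancel' hdv]
      have ht : (d1 : ℤ) - d2 * c = v * tpar v d1 d2 c := by
        unfold tpar; rw [Int.mul_ediv_cancel' (t_dvd hv hc hdv)]
      have hb : Nat.gcd b d2 = 1 := by
        rw [← Nat.coprime_iff_gcd_eq_one, ← Nat.isCoprime_iff_coprime]
        exact ⟨x, y, by linear_combination hxy⟩
      obtain ⟨q, hq⟩ := iinv_spec hd2 hb
      have hx : efn (((m * b + tpar v d1 d2 c * iinv b d2 : ℤ) : ℝ) / d2)
          = efn (((m * b + tpar v d1 d2 c * x : ℤ) : ℝ) / d2) := by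
        apply efn_div_congr hd2.ne'
        refine ⟨tpar v d1 d2 c * (iinv b d2 * y + x * q), ?_⟩
        linear_combination tpar v d1 d2 c * (-iinv b d2 * hxy + x * hq)
      rw [hx, ← efn_add]
      unfold parTerm
      change _ = efn (((spar v d1 d2 c * r + n * iinv r d1 : ℤ) : ℝ) / d1 + _)
      congr 1
      have hs' : (d2 : ℝ) - d1 * iinv c v = v * spar v d1 d2 c := by exact_mod_cast hs
      have ht' : (d1 : ℝ) - d2 * c = v * tpar v d1 d2 c := by exact_mod_cast ht
      push_cast
      field_simp
      linear_combination (r * d2 : ℝ) * hs' + (x * d1 : ℝ) * ht'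
    · simp
  · simp

lemma sum_gcd_split (D2 : ℕ) (hD2 : 0 < D2) (U : ℕ → ℂ) :
    ∑ B ∈ range D2, U B = ∑ v ∈ D2.divisors,
      ∑ b ∈ (range (D2 / v)).filter (fun b => Nat.gcd b (D2 / v) = 1), U (v * b) := by
  rw [← sum_fiberwise_of_maps_to (s := range D2) (t := D2.divisors) (g := fun B => Nat.gcd B D2)
    (fun B _ => Nat.mem_divisors.2 ⟨Nat.gcd_dvd_right _ _, hD2.ne'⟩)]
  refine sum_congr rfl fun v hv => ?_
  obtain ⟨⟨d2, rfl⟩, _⟩ := Nat.mem_divisors.1 hv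
  have hv0 : 0 < v := Nat.pos_of_mul_pos_right hD2
  rw [Nat.mul_div_cancel_left _ hv0]
  symm
  apply sum_nbij (fun b => v * b)
  · intro b hb
    simp only [mem_filter, mem_range] at hb ⊢
    refine ⟨Nat.mul_lt_mul_of_pos_left hb.1 hv0, ?_⟩
    rw [Nat.gcd_mul_left, hb.2, mul_one]
  · intro a _ b _ h
    exact Nat.eq_of_mul_eq_mul_left hv0 h
  · intro B hB
    simp only [coe_filter, mem_range, Set.mem_ofPred_eq] at hB
    have hvB : v ∣ B := by
      have := Nat.gcd_dvd_left B (v * d2)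
      rwa [hB.2] at this
    obtain ⟨b, rfl⟩ := hvB
    refine ⟨b, ?_, rfl⟩
    simp only [coe_filter, mem_range, Set.mem_ofPred_eq]
    refine ⟨Nat.lt_of_mul_lt_mul_left hB.1, ?_⟩
    have := hB.2
    rw [Nat.gcd_mul_left] at this
    exact Nat.eq_of_mul_eq_mul_left hv0 (by rw [this, mul_one])
  · intro b _; rfl

lemma SGL3_formula (m n : ℤ) (D1 D2 : ℕ) (hD1 : 0 < D1) (hD2 : 0 < D2) :
    SGL3 1 m n 1 D1 D2 = ∑ v ∈ (Nat.gcd D1 D2).divisors,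
      ∑ c ∈ (range v).filter (fun c => Nat.gcd c v = 1 ∧
          (v : ℤ) ∣ ((D2 / v : ℕ) : ℤ) - (D1 / v : ℕ) * iinv c v),
        (v : ℂ) * Kl (spar v (D1 / v) (D2 / v) c) n (D1 / v) *
          Kl m (tpar v (D1 / v) (D2 / v) c) (D2 / v) := by
  classical
  set U : ℕ → ℂ := fun B2 =>
    ∑ p ∈ (range D1 ×ˢ (range D1 ×ˢ range D2)).filter (fun p =>
      Nat.gcd p.1 (Nat.gcd p.2.1 D1) = 1 ∧ Nat.gcd B2 (Nat.gcd p.2.2 D2) = 1 ∧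
       (D1 * D2) ∣ (D1 * p.2.2 + p.1 * B2 + D2 * p.2.1)),
      efn ((((1 * p.1 + n * (Ycoef p.1 p.2.1 D1 * D2
          - Zcoef p.1 p.2.1 D1 * B2)) : ℤ) : ℝ) / D1
        + (((m * B2 + 1 * (Ycoef B2 p.2.2 D2 * D1
          - Zcoef B2 p.2.2 D2 * p.1)) : ℤ) : ℝ) / D2) with hU
  have h1 : SGL3 1 m n 1 D1 D2 = ∑ B2 ∈ range D2, U B2 := by
    unfold SGL3
    simp only [hU, sum_filter, sum_product]
    rw [sum_congr rfl fun B1 _ => sum_comm, sum_comm]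
  rw [h1, sum_gcd_split D2 hD2]
  have hsub : (Nat.gcd D1 D2).divisors ⊆ D2.divisors :=
    Nat.divisors_subset_of_dvd hD2.ne' (Nat.gcd_dvd_right _ _)
  rw [← sum_subset hsub]
  · refine sum_congr rfl fun v hv => ?_
    have hv' := (Nat.mem_divisors.1 hv).1
    obtain ⟨d1, rfl⟩ := hv'.trans (Nat.gcd_dvd_left _ _)
    obtain ⟨d2, rfl⟩ := hv'.trans (Nat.gcd_dvd_right _ _)
    have hv0 : 0 < v := Nat.pos_of_mul_pos_right hD2
    have hd1 : 0 < d1 := Nat.pos_of_mul_pos_left hD1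
    have hd2 : 0 < d2 := Nat.pos_of_mul_pos_left hD2
    rw [Nat.mul_div_cancel_left _ hv0, Nat.mul_div_cancel_left _ hv0]
    have h3 : ∀ b ∈ (range d2).filter (fun b => Nat.gcd b d2 = 1), U (v * b)
        = ∑ c ∈ (range v).filter (fun c => Nat.gcd c v = 1 ∧
          (v : ℤ) ∣ (d2 : ℤ) - d1 * iinv c v),
          (v : ℂ) * Kl (spar v d1 d2 c) n d1 *
          efn (((m * b + tpar v d1 d2 c * iinv b d2 : ℤ) : ℝ) / d2) := by
      intro b hb
      have hb1 : Nat.gcd b d2 = 1 := (mem_filter.1 hb).2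
      have hxy : (b:ℤ) * Nat.gcdA b d2 + d2 * Nat.gcdB b d2 = 1 := by
        rw [← Nat.gcd_eq_gcd_ab, hb1]; rfl
      have hcore := core v d1 d2 b hv0 hd1 hd2 _ _ hxy m n
      simp only [hU]
      rw [hcore, sum_filter, sum_product]
      rw [sum_filter]
      refine sum_congr rfl fun c _ => ?_
      by_cases hc : Nat.gcd c v = 1
      · have := ksum v d1 d2 b hv0 hd1 hd2 _ _ hxy m n c hc
        simp only [hc, true_and]
        exact this
      · simp [hc]
    rw [sum_congr rfl h3, sum_comm]
    refine sum_congr rfl fun c _ => ?_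
    rw [← mul_sum]
    congr 1
    unfold Kl
    rw [sum_filter]
    rfl
  · intro v hv hv2
    have hvD2 := (Nat.mem_divisors.1 hv).1
    have hvD1 : ¬ v ∣ D1 := by
      intro h
      exact hv2 (Nat.mem_divisors.2 ⟨Nat.dvd_gcd h hvD2, (Nat.gcd_pos_of_pos_left _ hD1).ne'⟩)
    refine sum_eq_zero fun b _ => ?_
    simp only [hU]
    refine sum_eq_zero ?_
    rintro ⟨B1, C1, C2⟩ hp
    exfalso
    simp only [mem_filter] at hp
    obtain ⟨_, _, g2, hd⟩ := hp
    obtain ⟨d2, rfl⟩ := hvD2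
    apply hvD1
    have hcop : Nat.Coprime v C2 := by
      apply Nat.coprime_of_dvd
      intro p hp h1 h2
      have : p ∣ Nat.gcd (v * b) (Nat.gcd C2 (v * d2)) :=
        Nat.dvd_gcd (h1.mul_right _) (Nat.dvd_gcd h2 (h1.mul_right _))
      rw [g2] at this
      exact hp.one_lt.ne' (Nat.dvd_one.1 this)
    have h5 : v ∣ D1 * C2 + B1 * (v * b) + v * d2 * C1 :=
      (Dvd.intro_left (D1) rfl : v * d2 ∣ D1 * (v * d2)) |>.trans hd |> (dvd_mul_right v d2).trans
    have h6 : v ∣ D1 * C2 := by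
      have h7 : v ∣ D1 * C2 + B1 * (v * b) :=
        (Nat.dvd_add_left (by exact ⟨d2 * C1, by ring⟩)).1 h5
      exact (Nat.dvd_add_left (by exact ⟨B1 * b, by ring⟩)).1 h7
    exact hcop.dvd_of_dvd_mul_right h6


lemma inv_val_facts {x q : ℕ} (hq : 0 < q) (h : Nat.gcd x q = 1) :
    ((x : ZMod q)⁻¹).val < q ∧ Nat.gcd ((x : ZMod q)⁻¹).val q = 1 ∧
      (((((x : ZMod q)⁻¹).val : ℕ) : ZMod q)⁻¹) = (x : ZMod q) := by
  have : NeZero q := ⟨hq.ne'⟩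
  have hu : (x : ZMod q) = (ZMod.unitOfCoprime x h : (ZMod q)ˣ) := by simp
  refine ⟨ZMod.val_lt _, ?_, ?_⟩
  · rw [hu, ZMod.inv_coe_unit]
    exact ZMod.val_coe_unit_coprime _
  · rw [ZMod.natCast_zmod_val, hu, ZMod.inv_coe_unit, ZMod.inv_coe_unit, inv_inv]

lemma sum_unit_inv {M : Type*} [AddCommMonoid M] (q : ℕ) (hq : 0 < q) (f : ℕ → ℕ → M) :
    ∑ x ∈ (range q).filter (fun x => Nat.gcd x q = 1), f x ((x : ZMod q)⁻¹).val
      = ∑ x ∈ (range q).filter (fun x => Nat.gcd x q = 1), f ((x : ZMod q)⁻¹).val x := by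
  have hval : ∀ x, x < q → Nat.gcd x q = 1 → (((((x : ZMod q)⁻¹).val : ℕ) : ZMod q)⁻¹).val = x := by
    intro x hx h
    rw [(inv_val_facts hq h).2.2, ZMod.val_natCast, Nat.mod_eq_of_lt hx]
  refine sum_nbij' (fun x => ((x : ZMod q)⁻¹).val) (fun x => ((x : ZMod q)⁻¹).val) ?_ ?_ ?_ ?_ ?_
  · intro x hx
    rw [mem_filter, mem_range] at hx ⊢
    exact ⟨(inv_val_facts hq hx.2).1, (inv_val_facts hq hx.2).2.1⟩
  · intro x hx
    rw [mem_filter, mem_range] at hx ⊢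
    exact ⟨(inv_val_facts hq hx.2).1, (inv_val_facts hq hx.2).2.1⟩
  · intro x hx
    rw [mem_filter, mem_range] at hx
    exact hval x hx.1 hx.2
  · intro x hx
    rw [mem_filter, mem_range] at hx
    exact hval x hx.1 hx.2
  · intro x hx
    rw [mem_filter, mem_range] at hx
    rw [hval x hx.1 hx.2]

lemma Kl_eq (s t : ℤ) (q : ℕ) : Kl s t q =
    ∑ x ∈ (range q).filter (fun x => Nat.gcd x q = 1),
      efn ((s : ℝ) * ((x : ℕ) / q)) * efn ((t : ℝ) * (((x : ZMod q)⁻¹).val / q)) := by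
  unfold Kl
  rw [sum_filter]
  refine sum_congr rfl fun x _ => ?_
  split_ifs with h
  · rw [← efn_add]; congr 1; push_cast; ring
  · rfl

lemma Kl_comm (s t : ℤ) (q : ℕ) (hq : 0 < q) : Kl s t q = Kl t s q := by
  rw [Kl_eq, Kl_eq]
  rw [sum_unit_inv q hq (fun x y => efn ((s : ℝ) * ((x : ℕ) / q)) * efn ((t : ℝ) * ((y : ℕ) / q)))]
  exact sum_congr rfl fun x _ => mul_comm _ _

/-- linear form in Kloosterman sums -/
noncomputable def PA (N : ℕ) (a : ℕ → ℂ) (q : ℕ) (s : ℤ) : ℂ := ∑ n ∈ Icc 1 N, a n * Kl s n q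

lemma PA_eq (N : ℕ) (a : ℕ → ℂ) (q : ℕ) (s : ℤ) : PA N a q s =
    ∑ x ∈ (range q).filter (fun x => Nat.gcd x q = 1),
      (∑ n ∈ Icc 1 N, a n * efn (n * ((((x : ZMod q)⁻¹).val : ℕ) / q : ℝ))) *
        efn ((s : ℝ) * (((x : ℤ) : ℝ) / q)) := by
  unfold PA
  simp_rw [Kl_eq, mul_sum, sum_mul]
  rw [sum_comm]
  refine sum_congr rfl fun x _ => sum_congr rfl fun n _ => ?_
  push_cast; ring

lemma PA_periodic (N : ℕ) (a : ℕ → ℂ) (q : ℕ) (hq : 0 < q) (s : ℤ) :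
    PA N a q s = PA N a q (((s % q).toNat : ℕ) : ℤ) := by
  have h0 : 0 ≤ s % (q : ℤ) := Int.emod_nonneg _ (by positivity)
  rw [PA_eq, PA_eq]
  refine sum_congr rfl fun x _ => ?_
  congr 1
  rw [Int.toNat_of_nonneg h0]
  have h1 := Int.emod_add_mul_ediv s q
  have hq' : (q : ℝ) ≠ 0 := by positivity
  apply efn_congr ((s / q) * x)
  have h2 : (s : ℝ) = ((s % q : ℤ) : ℝ) + q * ((s / q : ℤ) : ℝ) := by exact_mod_cast h1.symm
  rw [h2]
  push_cast
  field_simp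

lemma PA_parseval (N : ℕ) (a : ℕ → ℂ) (q : ℕ) (hq : 0 < q) :
    ∑ s ∈ range q, ‖PA N a q (s : ℤ)‖ ^ 2
      = q * ∑ b ∈ (range q).filter (fun b => Nat.Coprime b q),
        ‖∑ n ∈ Icc 1 N, a n * efn (n * ((b : ℝ) / q))‖ ^ 2 := by
  have h := parseval_mod q hq.ne' ((range q).filter (fun x => Nat.gcd x q = 1)) (fun x => (x : ℤ))
    (by
      intro i hi j hj hd
      rw [mem_filter, mem_range] at hi hj
      have := Int.eq_zero_of_abs_lt_dvd hd (by rw [abs_lt]; constructor <;> omega)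
      omega)
    (fun x => ∑ n ∈ Icc 1 N, a n * efn (n * ((((x : ZMod q)⁻¹).val : ℕ) / q : ℝ)))
  rw [sum_unit_inv q hq (fun _ y => ‖∑ n ∈ Icc 1 N, a n * efn (n * ((y : ℕ) / q : ℝ))‖ ^ 2)] at h
  rw [show (∑ b ∈ (range q).filter (fun b => Nat.Coprime b q),
        ‖∑ n ∈ Icc 1 N, a n * efn (n * ((b : ℝ) / q))‖ ^ 2) = _ from rfl]
  rw [← show _ = _ from h]
  refine sum_congr rfl fun s _ => ?_
  rw [PA_eq]
  push_cast
  rfl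

lemma count_lemma (v d Y : ℕ) (hv : 0 < v) (hd : 0 < d) (κ : ℕ → ℤ)
    (hκ : ∀ c < v, ∀ c' < v, Nat.gcd c v = 1 → Nat.gcd c' v = 1 → (v : ℤ) ∣ κ c - κ c' → c = c')
    (G : ℤ → ℝ) (hG : ∀ s, 0 ≤ G s) (hper : ∀ s, G s = G (((s % d).toNat : ℕ) : ℤ)) :
    ∑ e ∈ Icc 1 Y, ∑ c ∈ range v,
      (if Nat.gcd c v = 1 ∧ (v : ℤ) ∣ (e : ℤ) - d * κ c then G (((e : ℤ) - d * κ c) / v) else 0)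
      ≤ ((Y / d + 1 : ℕ) : ℝ) * ∑ s ∈ range d, G (s : ℤ) := by
  rw [← sum_product', ← sum_filter]
  have hd' : (0 : ℤ) < d := by positivity
  have hv' : (0 : ℤ) < v := by positivity
  set S := (Icc 1 Y ×ˢ range v).filter
    (fun p => Nat.gcd p.2 v = 1 ∧ (v : ℤ) ∣ (p.1 : ℤ) - d * κ p.2) with hS
  let φ : ℕ × ℕ → ℕ × ℕ := fun p =>
    (((((p.1 : ℤ) - d * κ p.2) / v) % d).toNat, (p.1 - 1) / d)
  have hinj : ∀ p ∈ S, ∀ p' ∈ S, φ p = φ p' → p = p' := by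
    rintro ⟨e, c⟩ hp ⟨e', c'⟩ hp' h
    simp only [hS, mem_filter, mem_product, mem_Icc, mem_range] at hp hp'
    obtain ⟨⟨⟨he, _⟩, hc⟩, hg, k, hk⟩ := hp
    obtain ⟨⟨⟨he', _⟩, hc'⟩, hg', k', hk'⟩ := hp'
    simp only [φ, Prod.mk.injEq] at h
    obtain ⟨h1, h2⟩ := h
    rw [hk, hk', Int.mul_ediv_cancel_left _ hv'.ne', Int.mul_ediv_cancel_left _ hv'.ne'] at h1
    have hk0 := Int.emod_nonneg k hd'.ne'
    have hk0' := Int.emod_nonneg k' hd'.ne'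
    have h3 : k % d = k' % d := by omega
    obtain ⟨w, hw⟩ := Int.ModEq.dvd (show k' ≡ k [ZMOD d] from h3.symm)
    have hee : e = e' := by
      have hdv : (d : ℤ) ∣ (e : ℤ) - e' :=
        ⟨v * w + (κ c - κ c'), by linear_combination hk - hk' + v * hw⟩
      have e1 := Nat.div_add_mod (e - 1) d
      have e2 := Nat.div_add_mod (e' - 1) d
      have e3 := Nat.mod_lt (e - 1) hd
      have e4 := Nat.mod_lt (e' - 1) hd
      rw [h2] at e1
      have := Int.eq_zero_of_abs_lt_dvd hdv (by rw [abs_lt]; constructor <;> omega)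
      omega
    subst hee
    have hcc : c = c' := by
      apply hκ c hc c' hc' hg hg'
      refine ⟨-w, ?_⟩
      have : (d : ℤ) * (κ c - κ c') = d * (v * -w) := by linear_combination hk' - hk - v * hw
      exact mul_left_cancel₀ hd'.ne' this
    rw [hcc]
  have himg : S.image φ ⊆ range d ×ˢ range (Y / d + 1) := by
    intro y hy
    obtain ⟨⟨e, c⟩, hp, rfl⟩ := mem_image.1 hy
    simp only [hS, mem_filter, mem_product, mem_Icc, mem_range] at hp
    simp only [φ, mem_product, mem_range]
    constructor
    · have := Int.emod_lt_of_pos (((e : ℤ) - d * κ c) / v) hd'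
      omega
    · have : (e - 1) / d ≤ Y / d := Nat.div_le_div_right (by omega)
      omega
  calc ∑ p ∈ S, G (((p.1 : ℤ) - d * κ p.2) / v)
      = ∑ p ∈ S, (fun y : ℕ × ℕ => G (y.1 : ℤ)) (φ p) := by
        refine sum_congr rfl fun p _ => ?_
        rw [hper]
    _ = ∑ y ∈ S.image φ, G (y.1 : ℤ) := (sum_image (f := fun y : ℕ × ℕ => G (y.1 : ℤ)) hinj).symm
    _ ≤ ∑ y ∈ range d ×ˢ range (Y / d + 1), G (y.1 : ℤ) :=
        sum_le_sum_of_subset_of_nonneg himg fun _ _ _ => hG _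
    _ = _ := by
        rw [sum_product, mul_sum]
        simp

lemma side_lemma (v U Y M N : ℕ) (hv : 0 < v) (hM : v * U + v * Y ≤ M) (κ : ℕ → ℤ)
    (hκ : ∀ c < v, ∀ c' < v, Nat.gcd c v = 1 → Nat.gcd c' v = 1 → (v : ℤ) ∣ κ c - κ c' → c = c')
    (a : ℕ → ℂ) :
    ∑ d ∈ Icc 1 U, ∑ e ∈ Icc 1 Y, ∑ c ∈ range v,
      (if Nat.gcd c v = 1 ∧ (v : ℤ) ∣ (e : ℤ) - d * κ c then
        (v : ℝ) * ‖PA N a d (((e : ℤ) - d * κ c) / v)‖ ^ 2 else 0)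
      ≤ M * (12 * Kphi * ((U : ℝ) ^ 2 + N) * ∑ n ∈ Icc 1 N, ‖a n‖ ^ 2) := by
  refine le_trans ?_ (mul_le_mul_of_nonneg_left (large_sieve U N a) (Nat.cast_nonneg M))
  rw [mul_sum]
  refine sum_le_sum fun d hd => ?_
  rw [mem_Icc] at hd
  have h := count_lemma v d Y hv hd.1 κ hκ (fun s => (v : ℝ) * ‖PA N a d s‖ ^ 2)
    (fun s => by positivity) (fun s => by rw [PA_periodic N a d hd.1])
  refine h.trans ?_
  rw [← mul_sum, PA_parseval N a d hd.1, ← mul_assoc, ← mul_assoc]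
  refine mul_le_mul_of_nonneg_right ?_ (sum_nonneg fun _ _ => by positivity)
  have h1 : (Y / d + 1) * v * d ≤ M := by
    have h2 := Nat.div_mul_le_self Y d
    have h3 : v * (Y / d * d) ≤ v * Y := Nat.mul_le_mul_left _ h2
    have h4 : v * d ≤ v * U := Nat.mul_le_mul_left _ hd.2
    nlinarith
  exact_mod_cast h1


lemma bilin_formula (N : ℕ) (a b : ℕ → ℂ) (D1 D2 : ℕ) (hD1 : 0 < D1) (hD2 : 0 < D2) :
    ∑ n ∈ Icc 1 N, ∑ m ∈ Icc 1 N, a n * b m * SGL3 1 (m : ℤ) (n : ℤ) 1 D1 D2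
      = ∑ v ∈ (Nat.gcd D1 D2).divisors, ∑ c ∈ (range v).filter (fun c => Nat.gcd c v = 1 ∧
          (v : ℤ) ∣ ((D2 / v : ℕ) : ℤ) - (D1 / v : ℕ) * iinv c v),
          (v : ℂ) * PA N a (D1 / v) (spar v (D1 / v) (D2 / v) c) *
            PA N b (D2 / v) (tpar v (D1 / v) (D2 / v) c) := by
  simp_rw [SGL3_formula _ _ D1 D2 hD1 hD2, mul_sum]
  rw [sum_congr rfl fun n _ => sum_comm, sum_comm]
  refine sum_congr rfl fun v hv => ?_
  rw [sum_congr rfl fun n _ => sum_comm, sum_comm]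
  refine sum_congr rfl fun c _ => ?_
  have hv' := (Nat.mem_divisors.1 hv).1
  have hd2 : 0 < D2 / v := Nat.div_pos (Nat.le_of_dvd hD2 (hv'.trans (Nat.gcd_dvd_right _ _)))
    (Nat.pos_of_mem_divisors hv)
  unfold PA
  rw [mul_assoc (v : ℂ), sum_mul_sum, mul_sum]
  refine sum_congr rfl fun n _ => ?_
  rw [mul_sum]
  refine sum_congr rfl fun m _ => ?_
  rw [Kl_comm (m : ℤ) _ _ hd2]
  ring

lemma divisor_reindex (F1 F2 : ℕ) (f : ℕ → ℕ → ℕ → ℝ) (hf : ∀ v d e, 0 ≤ f v d e) :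
    ∑ D1 ∈ Icc 1 F1, ∑ D2 ∈ Icc 1 F2, ∑ v ∈ (Nat.gcd D1 D2).divisors, f v (D1 / v) (D2 / v)
      ≤ ∑ v ∈ Icc 1 (min F1 F2), ∑ d ∈ Icc 1 (F1 / v), ∑ e ∈ Icc 1 (F2 / v), f v d e := by
  rw [sum_congr rfl fun D1 _ => sum_sigma' _ _ _, sum_sigma']
  have hR : ∀ v ∈ Icc 1 (min F1 F2), ∑ d ∈ Icc 1 (F1 / v), ∑ e ∈ Icc 1 (F2 / v), f v d e
    = ∑ p ∈ Icc 1 (F1 / v) ×ˢ Icc 1 (F2 / v), f v p.1 p.2 := fun v _ => (sum_product' _ _ _).symm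
  rw [sum_congr rfl hR, sum_sigma']
  let φ : (Σ _ : ℕ, Σ _ : ℕ, ℕ) → (Σ _ : ℕ, ℕ × ℕ) := fun p =>
    ⟨p.2.2, (p.1 / p.2.2, p.2.1 / p.2.2)⟩
  set S := (Icc 1 F1).sigma fun D1 => (Icc 1 F2).sigma fun D2 => (Nat.gcd D1 D2).divisors with hS
  have hinj : ∀ p ∈ S, ∀ p' ∈ S, φ p = φ p' → p = p' := by
    rintro ⟨D1, D2, v⟩ hp ⟨D1', D2', v'⟩ hp' h
    simp only [hS, mem_sigma, mem_Icc, Nat.mem_divisors, Nat.dvd_gcd_iff] at hp hp'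
    simp only [φ, Sigma.mk.injEq, heq_eq_eq, Prod.mk.injEq] at h
    obtain ⟨rfl, h1, h2⟩ := h
    have e1 : D1 = D1' := by
      rw [← Nat.div_mul_cancel hp.2.2.1.1, h1, Nat.div_mul_cancel hp'.2.2.1.1]
    have e2 : D2 = D2' := by
      rw [← Nat.div_mul_cancel hp.2.2.1.2, h2, Nat.div_mul_cancel hp'.2.2.1.2]
    rw [e1, e2]
  have himg : S.image φ ⊆ (Icc 1 (min F1 F2)).sigma
      fun v => Icc 1 (F1 / v) ×ˢ Icc 1 (F2 / v) := by
    intro y hy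
    obtain ⟨⟨D1, D2, v⟩, hp, rfl⟩ := mem_image.1 hy
    simp only [hS, mem_sigma, mem_Icc, Nat.mem_divisors, Nat.dvd_gcd_iff] at hp
    obtain ⟨⟨h1, h2⟩, ⟨h3, h4⟩, ⟨h5, h6⟩, _⟩ := hp
    have hv : 0 < v := Nat.pos_of_dvd_of_pos h5 h1
    have l1 := Nat.le_of_dvd h1 h5
    have l2 := Nat.le_of_dvd h3 h6
    simp only [φ, mem_sigma, mem_Icc, mem_product]
    refine ⟨⟨hv, le_min (by omega) (by omega)⟩, ⟨Nat.div_pos l1 hv, Nat.div_le_div_right h2⟩,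
      ⟨Nat.div_pos l2 hv, Nat.div_le_div_right h4⟩⟩
  calc _ = ∑ p ∈ S, (fun y : (Σ _ : ℕ, ℕ × ℕ) => f y.1 y.2.1 y.2.2) (φ p) := rfl
    _ = ∑ y ∈ S.image φ, f y.1 y.2.1 y.2.2 :=
        (sum_image (f := fun y : (Σ _ : ℕ, ℕ × ℕ) => f y.1 y.2.1 y.2.2) hinj).symm
    _ ≤ _ := sum_le_sum_of_subset_of_nonneg himg fun _ _ _ => hf _ _ _

lemma cs_weight {ι : Type*} (T : Finset ι) (w : ℝ) (hw : 0 ≤ w) (x y : ι → ℝ) (A B : ℝ)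
    (hA : ∑ i ∈ T, w * x i ^ 2 ≤ A) (hB : ∑ i ∈ T, w * y i ^ 2 ≤ B) :
    ∑ i ∈ T, w * x i * y i ≤ √A * √B := by
  have h := Real.sum_mul_le_sqrt_mul_sqrt T (fun i => √w * x i) (fun i => √w * y i)
  have e1 : ∀ z : ι → ℝ, ∑ i ∈ T, (√w * z i) ^ 2 = ∑ i ∈ T, w * z i ^ 2 := fun z =>
    sum_congr rfl fun i _ => by rw [mul_pow, Real.sq_sqrt hw]
  rw [e1, e1] at h
  have e2 : ∑ i ∈ T, w * x i * y i = ∑ i ∈ T, (√w * x i) * (√w * y i) :=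
    sum_congr rfl fun i _ => by
      linear_combination (-(x i * y i)) * Real.mul_self_sqrt hw
  rw [e2]
  refine h.trans ?_
  gcongr

lemma fixed_v (v U Y M N : ℕ) (hv : 0 < v) (hM : v * U + v * Y ≤ M) (a b : ℕ → ℂ) :
    ∑ d ∈ Icc 1 U, ∑ e ∈ Icc 1 Y, ∑ c ∈ (range v).filter (fun c => Nat.gcd c v = 1 ∧
          (v : ℤ) ∣ (e : ℤ) - d * iinv c v),
          (v : ℝ) * ‖PA N a d (spar v d e c)‖ * ‖PA N b e (tpar v d e c)‖
      ≤ √(M * (12 * Kphi * ((U : ℝ) ^ 2 + N) * ∑ n ∈ Icc 1 N, ‖a n‖ ^ 2)) *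
        √(M * (12 * Kphi * ((Y : ℝ) ^ 2 + N) * ∑ n ∈ Icc 1 N, ‖b n‖ ^ 2)) := by
  simp_rw [sum_filter]
  have hA := side_lemma v U Y M N hv hM (fun c => iinv c v) (by
    intro c hc c' hc' hg hg' ⟨k, hk⟩
    obtain ⟨w, hw⟩ := iinv_spec hv hg
    obtain ⟨w', hw'⟩ := iinv_spec hv hg'
    have hd : (v : ℤ) ∣ (c : ℤ) - c' :=
      ⟨c' * w - c * w' - c * c' * k, by
        linear_combination (-(c:ℤ)) * hw' + (c':ℤ) * hw - (c:ℤ) * c' * hk⟩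
    have := Int.eq_zero_of_abs_lt_dvd hd (by rw [abs_lt]; constructor <;> omega)
    omega) a
  have hB := side_lemma v Y U M N hv (by omega) (fun c => (c : ℤ)) (by
    intro c hc c' hc' hg hg' hd
    have := Int.eq_zero_of_abs_lt_dvd hd (by rw [abs_lt]; constructor <;> omega)
    omega) b
  rw [sum_comm] at hB
  have hB2 : ∑ d ∈ Icc 1 U, ∑ e ∈ Icc 1 Y, ∑ c ∈ range v,
      (if Nat.gcd c v = 1 ∧ (v : ℤ) ∣ (e : ℤ) - d * iinv c v then
        (v : ℝ) * ‖PA N b e (tpar v d e c)‖ ^ 2 else 0)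
      ≤ M * (12 * Kphi * ((Y : ℝ) ^ 2 + N) * ∑ n ∈ Icc 1 N, ‖b n‖ ^ 2) := by
    refine le_trans ?_ hB
    refine sum_le_sum fun d _ => sum_le_sum fun e _ => sum_le_sum fun c _ => ?_
    by_cases h : Nat.gcd c v = 1 ∧ (v : ℤ) ∣ (e : ℤ) - d * iinv c v
    · rw [if_pos h, if_pos ⟨h.1, t_dvd hv h.1 h.2⟩]
      exact le_of_eq rfl
    · rw [if_neg h]
      split_ifs <;> positivity
  simp_rw [← sum_product', ← sum_filter] at hA hB2 ⊢
  exact cs_weight _ _ (by positivity) _ _ _ _ hA hB2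

lemma sum_inv_sq (m : ℕ) : ∑ v ∈ Icc 1 m, ((v : ℝ) ^ 2)⁻¹ ≤ 2 - (m : ℝ)⁻¹ := by
  induction m with
  | zero => simp
  | succ m ih =>
    rw [sum_Icc_succ_top (by omega)]
    rcases Nat.eq_zero_or_pos m with rfl | hm
    · norm_num
    · have hm' : (0 : ℝ) < m := by positivity
      have : (((m + 1 : ℕ) : ℝ) ^ 2)⁻¹ ≤ (m : ℝ)⁻¹ - ((m + 1 : ℕ) : ℝ)⁻¹ := by
        push_cast
        rw [inv_sub_inv (by positivity) (by positivity), inv_eq_one_div]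
        rw [div_le_div_iff₀ (by positivity) (by positivity)]
        nlinarith
      linarith

lemma sum_v (m F N : ℕ) : ∑ v ∈ Icc 1 m, ((((F / v : ℕ) : ℝ)) ^ 2 + N) ≤ 2 * (F : ℝ) ^ 2 + m * N := by
  rw [sum_add_distrib]
  have h1 : ∑ v ∈ Icc 1 m, (((F / v : ℕ) : ℝ)) ^ 2 ≤ (F : ℝ) ^ 2 * ∑ v ∈ Icc 1 m, ((v : ℝ) ^ 2)⁻¹ := by
    rw [mul_sum]
    refine sum_le_sum fun v _ => ?_
    have : ((F / v : ℕ) : ℝ) ≤ (F : ℝ) / v := Nat.cast_div_le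
    calc _ ≤ ((F : ℝ) / v) ^ 2 := by gcongr
      _ = _ := by rw [div_pow, div_eq_mul_inv]
  have h2 := sum_inv_sq m
  have h3 : (0 : ℝ) ≤ (m : ℝ)⁻¹ := by positivity
  have h4 : (F : ℝ) ^ 2 * ∑ v ∈ Icc 1 m, ((v : ℝ) ^ 2)⁻¹ ≤ (F : ℝ) ^ 2 * 2 := by
    gcongr; linarith
  simp only [sum_const, Nat.card_Icc, nsmul_eq_mul, Nat.add_sub_cancel]
  linarith

lemma main_nat (F1 F2 N : ℕ) (a b : ℕ → ℂ) :
    ∑ D1 ∈ Icc 1 F1, ∑ D2 ∈ Icc 1 F2,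
      ‖∑ n ∈ Icc 1 N, ∑ m ∈ Icc 1 N, a n * b m * SGL3 1 (m : ℤ) (n : ℤ) 1 D1 D2‖
    ≤ √(((F1 + F2 : ℕ) : ℝ) * (12 * Kphi * (2 * (F1 : ℝ) ^ 2 + (min F1 F2 : ℕ) * N) *
          ∑ n ∈ Icc 1 N, ‖a n‖ ^ 2)) *
      √(((F1 + F2 : ℕ) : ℝ) * (12 * Kphi * (2 * (F2 : ℝ) ^ 2 + (min F1 F2 : ℕ) * N) *
          ∑ n ∈ Icc 1 N, ‖b n‖ ^ 2)) := by
  have hK := Kphi_nonneg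
  let f : ℕ → ℕ → ℕ → ℝ := fun v d e =>
    ∑ c ∈ (range v).filter (fun c => Nat.gcd c v = 1 ∧ (v : ℤ) ∣ (e : ℤ) - d * iinv c v),
          (v : ℝ) * ‖PA N a d (spar v d e c)‖ * ‖PA N b e (tpar v d e c)‖
  have hf : ∀ v d e, 0 ≤ f v d e := fun v d e => sum_nonneg fun _ _ => by positivity
  have h1 : ∑ D1 ∈ Icc 1 F1, ∑ D2 ∈ Icc 1 F2,
      ‖∑ n ∈ Icc 1 N, ∑ m ∈ Icc 1 N, a n * b m * SGL3 1 (m : ℤ) (n : ℤ) 1 D1 D2‖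
      ≤ ∑ D1 ∈ Icc 1 F1, ∑ D2 ∈ Icc 1 F2, ∑ v ∈ (Nat.gcd D1 D2).divisors,
          f v (D1 / v) (D2 / v) := by
    refine sum_le_sum fun D1 h1 => sum_le_sum fun D2 h2 => ?_
    rw [mem_Icc] at h1 h2
    rw [bilin_formula N a b D1 D2 h1.1 h2.1]
    refine (norm_sum_le _ _).trans (sum_le_sum fun v _ => ?_)
    refine (norm_sum_le _ _).trans (sum_le_sum fun c _ => ?_)
    simp
  refine h1.trans ((divisor_reindex F1 F2 f hf).trans ?_)
  set M : ℕ := F1 + F2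
  set SA := ∑ n ∈ Icc 1 N, ‖a n‖ ^ 2
  set SB := ∑ n ∈ Icc 1 N, ‖b n‖ ^ 2
  have hSA : 0 ≤ SA := sum_nonneg fun _ _ => by positivity
  have hSB : 0 ≤ SB := sum_nonneg fun _ _ => by positivity
  have h2 : ∀ v ∈ Icc 1 (min F1 F2), ∑ d ∈ Icc 1 (F1 / v), ∑ e ∈ Icc 1 (F2 / v), f v d e ≤
      √(M * (12 * Kphi * (((F1 / v : ℕ) : ℝ) ^ 2 + N) * SA)) *
        √(M * (12 * Kphi * (((F2 / v : ℕ) : ℝ) ^ 2 + N) * SB)) := by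
    intro v hv
    rw [mem_Icc] at hv
    exact fixed_v v _ _ M N hv.1 (Nat.add_le_add (Nat.mul_div_le _ _) (Nat.mul_div_le _ _)) a b
  refine (sum_le_sum h2).trans ?_
  refine (Real.sum_sqrt_mul_sqrt_le _ (fun v => by positivity) (fun v => by positivity)).trans ?_
  have key : ∀ F : ℕ, ∀ S : ℝ, 0 ≤ S →
      ∑ v ∈ Icc 1 (min F1 F2), (M : ℝ) * (12 * Kphi * (((F / v : ℕ) : ℝ) ^ 2 + N) * S)
      ≤ M * (12 * Kphi * (2 * (F : ℝ) ^ 2 + (min F1 F2 : ℕ) * N) * S) := by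
    intro F S hS
    rw [← mul_sum, ← sum_mul, ← mul_sum]
    gcongr
    exact sum_v _ _ _
  gcongr
  · exact key F1 SA hSA
  · exact key F2 SB hSB

lemma final_ineq (X1 X2 N m : ℝ) (h1 : 1 ≤ X1) (h2 : 1 ≤ X2) (hN : 1 ≤ N) (hm : 0 ≤ m)
    (hm1 : m ≤ X1) (hm2 : m ≤ X2) :
    (X1 + X2) ^ 2 * ((2 * X1 ^ 2 + m * N) * (2 * X2 ^ 2 + m * N)) ≤
      4 * (X1 * X2 * (X1 + X2) + (N * X1 * X2) ^ ((1 : ℝ) / 2) *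
                (X1 + X2) ^ ((3 : ℝ) / 2) + N * X1 * X2) ^ 2 := by
  set R := (N * X1 * X2) ^ ((1 : ℝ) / 2) * (X1 + X2) ^ ((3 : ℝ) / 2) with hR
  have hR0 : 0 ≤ R := by positivity
  have hR2 : R ^ 2 = N * X1 * X2 * (X1 + X2) ^ 3 := by
    rw [hR, mul_pow, ← Real.rpow_natCast, ← Real.rpow_natCast, ← Real.rpow_mul (by positivity),
      ← Real.rpow_mul (by positivity)]
    norm_num
  set P := X1 * X2 with hP
  set M := X1 + X2 with hMdef
  have hP0 : 0 < P := by positivity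
  have hM0 : 0 < M := by positivity
  have hmM : m * M ≤ 2 * P := by rw [hP, hMdef]; nlinarith
  have hmM0 : 0 ≤ m * M := by positivity
  have hsq : X1 ^ 2 + X2 ^ 2 ≤ M ^ 2 := by rw [hMdef]; nlinarith
  have t1 : (m * M) ^ 2 * N ^ 2 ≤ 4 * (P ^ 2 * N ^ 2) := by
    have : (m * M) ^ 2 ≤ (2 * P) ^ 2 := by gcongr
    nlinarith [sq_nonneg N]
  have t2 : 2 * N * (m * M) * (M * (X1 ^ 2 + X2 ^ 2)) ≤ 2 * N * (2 * P) * (M * M ^ 2) := by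
    gcongr
  have e1 : M ^ 2 * ((2 * X1 ^ 2 + m * N) * (2 * X2 ^ 2 + m * N))
      = 4 * (P ^ 2 * M ^ 2) + 2 * N * (m * M) * (M * (X1 ^ 2 + X2 ^ 2)) + (m * M) ^ 2 * N ^ 2 := by
    rw [hP]; ring
  have e2 : (P * M + R + N * X1 * X2) ^ 2 = P ^ 2 * M ^ 2 + N * P * M ^ 3 + P ^ 2 * N ^ 2
      + (2 * P * M * R + 2 * P * M * (N * P) + 2 * R * (N * P)) := by
    have : R ^ 2 = N * P * M ^ 3 := by rw [hR2, hP]; ring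
    rw [← this, hP]; ring
  rw [e1, e2]
  have t3 : 0 ≤ 2 * P * M * R + 2 * P * M * (N * P) + 2 * R * (N * P) := by positivity
  nlinarith

theorem stmt13 (ε : ℝ) (hε : 0 < ε) :
    ∃ C : ℝ, 0 < C ∧
      ∀ (X1 X2 N : ℝ), 1 ≤ X1 → 1 ≤ X2 → 1 ≤ N → ∀ a b : ℕ → ℂ,
        (∑ D1 ∈ Finset.Icc 1 ⌊X1⌋₊, ∑ D2 ∈ Finset.Icc 1 ⌊X2⌋₊,
            ‖∑ n ∈ Finset.Icc 1 ⌊N⌋₊, ∑ m ∈ Finset.Icc 1 ⌊N⌋₊,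
                a n * b m * SGL3 1 (m : ℤ) (n : ℤ) 1 D1 D2‖)
          ≤ C * (X1 * X2) ^ ε *
              Real.sqrt (∑ n ∈ Finset.Icc 1 ⌊N⌋₊, ‖a n‖ ^ 2) *
              Real.sqrt (∑ m ∈ Finset.Icc 1 ⌊N⌋₊, ‖b m‖ ^ 2) *
              (X1 * X2 * (X1 + X2) + (N * X1 * X2) ^ ((1 : ℝ) / 2) *
                (X1 + X2) ^ ((3 : ℝ) / 2) + N * X1 * X2) := by
  have hK := Kphi_nonneg
  refine ⟨24 * Kphi + 1, by positivity, ?_⟩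
  intro X1 X2 N h1 h2 hN a b
  refine (main_nat ⌊X1⌋₊ ⌊X2⌋₊ ⌊N⌋₊ a b).trans ?_
  set SA := ∑ n ∈ Finset.Icc 1 ⌊N⌋₊, ‖a n‖ ^ 2
  set SB := ∑ n ∈ Finset.Icc 1 ⌊N⌋₊, ‖b n‖ ^ 2
  have hSA : 0 ≤ SA := sum_nonneg fun _ _ => by positivity
  have hSB : 0 ≤ SB := sum_nonneg fun _ _ => by positivity
  have f1 : (⌊X1⌋₊ : ℝ) ≤ X1 := Nat.floor_le (by linarith)
  have f2 : (⌊X2⌋₊ : ℝ) ≤ X2 := Nat.floor_le (by linarith)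
  have f3 : (⌊N⌋₊ : ℝ) ≤ N := Nat.floor_le (by linarith)
  set m : ℝ := ((min ⌊X1⌋₊ ⌊X2⌋₊ : ℕ) : ℝ) with hm
  have hm0 : 0 ≤ m := Nat.cast_nonneg _
  have hm1 : m ≤ X1 := le_trans (by rw [hm]; exact_mod_cast min_le_left _ _) f1
  have hm2 : m ≤ X2 := le_trans (by rw [hm]; exact_mod_cast min_le_right _ _) f2
  have hfin := final_ineq X1 X2 N m h1 h2 hN hm0 hm1 hm2
  set st := X1 * X2 * (X1 + X2) + (N * X1 * X2) ^ ((1 : ℝ) / 2) *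
                (X1 + X2) ^ ((3 : ℝ) / 2) + N * X1 * X2 with hst
  have hst0 : 0 ≤ st := by positivity
  have hpow : 1 ≤ (X1 * X2) ^ ε := Real.one_le_rpow (by nlinarith) hε.le
  have hM : ((⌊X1⌋₊ + ⌊X2⌋₊ : ℕ) : ℝ) ≤ X1 + X2 := by push_cast; linarith
  have step : √(((⌊X1⌋₊ + ⌊X2⌋₊ : ℕ) : ℝ) * (12 * Kphi * (2 * (⌊X1⌋₊ : ℝ) ^ 2 + m * ⌊N⌋₊) * SA)) *
      √(((⌊X1⌋₊ + ⌊X2⌋₊ : ℕ) : ℝ) * (12 * Kphi * (2 * (⌊X2⌋₊ : ℝ) ^ 2 + m * ⌊N⌋₊) * SB))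
      ≤ √((X1 + X2) * (12 * Kphi * (2 * X1 ^ 2 + m * N) * SA)) *
      √((X1 + X2) * (12 * Kphi * (2 * X2 ^ 2 + m * N) * SB)) := by
    gcongr
  refine step.trans ?_
  rw [← Real.sqrt_mul (by positivity)]
  have hsq : √((X1 + X2) * (12 * Kphi * (2 * X1 ^ 2 + m * N) * SA) *
      ((X1 + X2) * (12 * Kphi * (2 * X2 ^ 2 + m * N) * SB))) ≤ 24 * Kphi * √SA * √SB * st := by
    apply Real.sqrt_le_iff.2
    refine ⟨by positivity, ?_⟩
    have e : (24 * Kphi * √SA * √SB * st) ^ 2 = (12 * Kphi) ^ 2 * SA * SB * (4 * st ^ 2) := by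
      rw [mul_pow, mul_pow, mul_pow, Real.sq_sqrt hSA, Real.sq_sqrt hSB]; ring
    rw [e]
    calc _ = (12 * Kphi) ^ 2 * SA * SB *
        ((X1 + X2) ^ 2 * ((2 * X1 ^ 2 + m * N) * (2 * X2 ^ 2 + m * N))) := by ring
      _ ≤ _ := by gcongr
  refine hsq.trans ?_
  have hc : 24 * Kphi ≤ (24 * Kphi + 1) * (X1 * X2) ^ ε := by nlinarith
  gcongr
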